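/- For each n, let (X_n, Y_n) be the endpoint of a uniformly random walk on the slit plane of length n. Then as n → ∞: 𝔼(X_n) ∼ (Γ(3/4)/Γ(1/4))·√n; 𝔼(Y_n) = 0 for all n; 𝔼(√(X_n² + Y_n²)) ∼ 3·(Γ(3/4)/Γ(1/4))·√n; 𝔼(X_n²) ∼ (7/12)·n; and 𝔼(Y_n²) ∼ (2/3)·n. -/

import Mathlib

open Filter

/-- The forbidden half-line `H = {(k,0) : k ≤ 0}`. -/
def slitH : Set (ℤ × ℤ) := {p : ℤ × ℤ | p.2 = 0 ∧ p.1 ≤ 0}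

/-- The four steps of the ordinary square lattice. -/
def sqSteps : Set (ℤ × ℤ) := {(1,0), (-1,0), (0,1), (0,-1)}

/-- The four diagonal steps. -/
def diagSteps : Set (ℤ × ℤ) := {(1,1), (1,-1), (-1,1), (-1,-1)}

/-- `w : Fin (n+1) → ℤ × ℤ` is a walk on the slit plane with steps in `A`. -/
def IsSlitWalk (A : Set (ℤ × ℤ)) (n : ℕ) (w : Fin (n+1) → ℤ × ℤ) : Prop :=
  w 0 = (0,0) ∧ (∀ m : Fin n, w m.succ - w m.castSucc ∈ A) ∧
    ∀ m : Fin (n+1), 1 ≤ (m : ℕ) → w m ∉ slitH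

/-- `a_{i,j}(n)`: the number of walks on the slit plane of length `n` ending at `(i,j)`. -/
noncomputable def slitCount (A : Set (ℤ × ℤ)) (i j : ℤ) (n : ℕ) : ℕ :=
  Nat.card {w : Fin (n+1) → ℤ × ℤ // IsSlitWalk A n w ∧ w (Fin.last n) = (i, j)}
/-- `a(n)`: the total number of walks on the slit plane of length `n`. -/
noncomputable def slitTotal (A : Set (ℤ × ℤ)) (n : ℕ) : ℕ :=
  Nat.card {w : Fin (n+1) → ℤ × ℤ // IsSlitWalk A n w}

/-- `𝔼(φ(Xₙ,Yₙ))`, the average over all `n`-step walks on the slit plane of a function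
`φ` of the endpoint `(Xₙ,Yₙ)`. -/
noncomputable def endpointMean (φ : ℤ × ℤ → ℝ) (n : ℕ) : ℝ :=
  (∑' p : ℤ × ℤ, (slitCount sqSteps p.1 p.2 n : ℝ) * φ p) / (slitTotal sqSteps n : ℝ)

namespace SlitAux

/-! ### Part A: walks and the operators -/

/-- walks as a type -/
def Walk (n : ℕ) : Type := {w : Fin (n+1) → ℤ × ℤ // IsSlitWalk sqSteps n w}

/-- endpoint -/
def Walk.last {n : ℕ} (w : Walk n) : ℤ × ℤ := w.1 (Fin.last n)

/-- allowed continuations of a walk -/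
def Cont (z : ℤ × ℤ) : Type := {e : ℤ × ℤ // e ∈ sqSteps ∧ z + e ∉ slitH}

/-- decomposition of a walk according to its last step -/
def walkEquiv (n : ℕ) : Walk (n+1) ≃ (Σ w : Walk n, Cont w.last) where
  toFun w := ⟨⟨Fin.init w.1, by
      obtain ⟨w, h0, h1, h2⟩ := w
      refine ⟨h0, fun m => ?_, fun m hm => ?_⟩
      · exact h1 m.castSucc
      · exact h2 m.castSucc hm⟩, ⟨w.1 (Fin.last (n+1)) - w.1 (Fin.last n).castSucc, by
      obtain ⟨w, h0, h1, h2⟩ := w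
      refine ⟨h1 (Fin.last n), ?_⟩
      have := h2 (Fin.last (n+1)) (by simp)
      simpa [Walk.last, Fin.init] using this⟩⟩
  invFun p := ⟨Fin.snoc (α := fun _ => ℤ × ℤ) p.1.1 (p.1.last + p.2.1), by
      obtain ⟨⟨w, h0, h1, h2⟩, ⟨e, he, he2⟩⟩ := p
      refine ⟨?_, fun m => ?_, fun m hm => ?_⟩
      · have : (0 : Fin (n+1+1)) = (0 : Fin (n+1)).castSucc := rfl
        rw [this, Fin.snoc_castSucc]; exact h0
      · refine Fin.lastCases ?_ (fun i => ?_) m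
        · rw [Fin.succ_last, Fin.snoc_last, Fin.snoc_castSucc]
          simpa [Walk.last] using he
        · rw [Fin.succ_castSucc, Fin.snoc_castSucc, Fin.snoc_castSucc]
          exact h1 i
      · revert hm
        refine Fin.lastCases ?_ (fun i => ?_) m
        · intro _; rw [Fin.snoc_last]; exact he2
        · intro hi; rw [Fin.snoc_castSucc]; exact h2 i hi⟩
  left_inv w := by
    apply Subtype.ext
    have : w.1 (Fin.last (n+1)) = w.1 (Fin.last n).castSucc +
      (w.1 (Fin.last (n+1)) - w.1 (Fin.last n).castSucc) := by abel
    simp only [Walk.last, Fin.init]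
    rw [← this]
    exact Fin.snoc_init_self (α := fun _ => ℤ × ℤ) w.1
  right_inv p := by
    obtain ⟨⟨w, hw⟩, ⟨e, he⟩⟩ := p
    have h1 : Fin.init (Fin.snoc (α := fun _ => ℤ × ℤ) w (w (Fin.last n) + e)) = w :=
      Fin.init_snoc _ _
    refine Sigma.ext ?_ ?_
    · exact Subtype.ext h1
    · refine (Subtype.heq_iff_coe_eq ?_).2 ?_
      · intro x
        simp only [Walk.last, h1]
      · simp only [Walk.last, Fin.snoc_last, Fin.snoc_castSucc]
        abel

theorem walkEquiv_last (n : ℕ) (w : Walk (n+1)) :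
    w.last = (walkEquiv n w).1.last + (walkEquiv n w).2.1 := by
  change w.1 (Fin.last (n+1)) = w.1 (Fin.last n).castSucc +
      (w.1 (Fin.last (n+1)) - w.1 (Fin.last n).castSucc)
  abel

instance (z : ℤ × ℤ) : Finite (Cont z) := by
  have : (sqSteps).Finite := by unfold sqSteps; exact Set.toFinite _
  have h2 : {e : ℤ × ℤ | e ∈ sqSteps ∧ z + e ∉ slitH}.Finite := this.subset (fun e he => he.1)
  exact h2.to_subtype

instance finiteWalk : ∀ n : ℕ, Finite (Walk n)
  | 0 => by
    have : Subsingleton (Walk 0) := by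
      constructor
      rintro ⟨w, h⟩ ⟨w', h'⟩
      apply Subtype.ext
      funext i
      have : i = 0 := Fin.ext (by have := i.2; simp)
      subst this
      exact h.1.trans h'.1.symm
    infer_instance
  | n+1 => by
    have := finiteWalk n
    exact Finite.of_equiv _ (walkEquiv n).symm

noncomputable instance (n : ℕ) : Fintype (Walk n) := Fintype.ofFinite _
noncomputable instance (z : ℤ × ℤ) : Fintype (Cont z) := Fintype.ofFinite _

/-- average over neighbours -/
noncomputable def stepAvg (f : ℤ × ℤ → ℝ) (z : ℤ × ℤ) : ℝ :=
  (f (z.1+1, z.2) + f (z.1-1, z.2) + f (z.1, z.2+1) + f (z.1, z.2-1)) / 4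

/-- unnormalised expectation -/
noncomputable def En (n : ℕ) (f : ℤ × ℤ → ℝ) : ℝ := (∑ w : Walk n, f w.last) / 4 ^ n

theorem sum_cont (f : ℤ × ℤ → ℝ) (z : ℤ × ℤ) :
    ∑ e : Cont z, f (z + e.1) = 4 * stepAvg (slitHᶜ.indicator f) z := by
  classical
  have h1 : ∑ e : Cont z, f (z + e.1) =
      ∑ e ∈ ({(1,0), (-1,0), (0,1), (0,-1)} : Finset (ℤ × ℤ)), slitHᶜ.indicator f (z + e) := by
    have : ∀ e : Cont z, f (z + e.1) = slitHᶜ.indicator f (z + e.1) := by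
      intro e
      rw [Set.indicator_of_mem]
      exact e.2.2
    simp_rw [this]
    rw [← Finset.sum_filter_add_sum_filter_not _ (fun e => z + e ∉ slitH)]
    rw [Finset.sum_eq_zero (s := Finset.filter (fun e => ¬ (z + e ∉ slitH)) _)]
    · rw [add_zero]
      symm
      apply Finset.sum_subtype (p := fun e => e ∈ sqSteps ∧ z + e ∉ slitH)
      intro e
      simp [sqSteps]
    · intro e he
      rw [Finset.mem_filter] at he
      rw [Set.indicator_of_notMem]
      exact he.2
  rw [h1, stepAvg]
  rw [Finset.sum_insert (by decide), Finset.sum_insert (by decide), Finset.sum_insert (by decide),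
    Finset.sum_singleton]
  have e1 : z + (1,0) = (z.1+1, z.2) := by ext <;> simp
  have e2 : z + (-1,0) = (z.1-1, z.2) := by ext <;> simp [sub_eq_add_neg]
  have e3 : z + (0,1) = (z.1, z.2+1) := by ext <;> simp
  have e4 : z + (0,-1) = (z.1, z.2-1) := by ext <;> simp [sub_eq_add_neg]
  rw [e1, e2, e3, e4]
  ring

theorem En_succ (n : ℕ) (f : ℤ × ℤ → ℝ) :
    En (n+1) f = En n (stepAvg (slitHᶜ.indicator f)) := by
  unfold En
  have : ∑ w : Walk (n+1), f w.last = ∑ p : (Σ w : Walk n, Cont w.last), f (p.1.last + p.2.1) := by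
    apply Fintype.sum_equiv (walkEquiv n)
    intro w
    rw [walkEquiv_last]
  rw [this, Fintype.sum_sigma]
  simp_rw [sum_cont]
  rw [← Finset.mul_sum, pow_succ]
  field_simp

theorem En_zero (f : ℤ × ℤ → ℝ) : En 0 f = f (0,0) := by
  unfold En
  have hu : ∃ w0 : Walk 0, ∀ w : Walk 0, w = w0 := by
    refine ⟨⟨fun _ => (0,0), rfl, fun m => m.elim0, fun m hm => by
      have := m.2; omega⟩, fun w => ?_⟩
    apply Subtype.ext
    funext i
    have : i = 0 := Fin.ext (by have := i.2; simp)
    subst this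
    exact w.2.1
  obtain ⟨w0, hw0⟩ := hu
  have : ∀ w : Walk 0, f w.last = f (0,0) := by
    intro w
    have : w.last = (0,0) := w.2.1
    rw [this]
  rw [Fintype.sum_eq_single w0 (fun w hw => absurd (hw0 w) hw), this]
  simp

theorem endpointMean_eq (φ : ℤ × ℤ → ℝ) (n : ℕ) :
    endpointMean φ n = En n φ / En n (fun _ => 1) := by
  classical
  have h1 : ∑' p : ℤ × ℤ, (slitCount sqSteps p.1 p.2 n : ℝ) * φ p = ∑ w : Walk n, φ w.last := by
    have hc : ∀ p : ℤ × ℤ, slitCount sqSteps p.1 p.2 n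
        = (Finset.univ.filter (fun w : Walk n => w.last = p)).card := by
      intro p
      unfold slitCount
      rw [← Fintype.card_subtype, ← Nat.card_eq_fintype_card]
      exact Nat.card_congr (Equiv.subtypeSubtypeEquivSubtypeInter _ _).symm
    rw [tsum_eq_sum (s := Finset.univ.image (fun w : Walk n => w.last))]
    · rw [← Finset.sum_fiberwise_of_maps_to (s := Finset.univ)
        (t := Finset.univ.image (fun w : Walk n => w.last)) (g := fun w : Walk n => w.last)
        (fun w _ => Finset.mem_image_of_mem _ (Finset.mem_univ w))]
      apply Finset.sum_congr rfl
      intro p _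
      rw [hc, ← nsmul_eq_mul, ← Finset.sum_const]
      apply Finset.sum_congr rfl
      intro w hw
      rw [(Finset.mem_filter.1 hw).2]
    · intro p hp
      rw [hc, Finset.card_eq_zero.2, Nat.cast_zero, zero_mul]
      rw [Finset.filter_eq_empty_iff]
      intro w _ hw
      exact hp (Finset.mem_image.2 ⟨w, Finset.mem_univ _, hw⟩)
  unfold endpointMean En
  rw [h1]
  have h2 : (slitTotal sqSteps n : ℝ) = ∑ w : Walk n, (1:ℝ) := by
    simp only [Finset.sum_const, nsmul_eq_mul, mul_one, Finset.card_univ]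
    rw [← Nat.card_eq_fintype_card]; rfl
  rw [h2, div_div_div_cancel_right₀ (by positivity)]

theorem En_mono (n : ℕ) {f g : ℤ × ℤ → ℝ} (h : ∀ z, f z ≤ g z) : En n f ≤ En n g := by
  unfold En
  gcongr
  exact h _

theorem En_add (n : ℕ) (f g : ℤ × ℤ → ℝ) : En n (fun z => f z + g z) = En n f + En n g := by
  unfold En; rw [Finset.sum_add_distrib]; ring

theorem En_sub (n : ℕ) (f g : ℤ × ℤ → ℝ) : En n (fun z => f z - g z) = En n f - En n g := by
  unfold En; rw [Finset.sum_sub_distrib]; ring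

theorem En_smul (n : ℕ) (c : ℝ) (f : ℤ × ℤ → ℝ) : En n (fun z => c * f z) = c * En n f := by
  unfold En; rw [← Finset.mul_sum]; ring

theorem En_nonneg (n : ℕ) {f : ℤ × ℤ → ℝ} (h : ∀ z, 0 ≤ f z) : 0 ≤ En n f := by
  unfold En
  exact div_nonneg (Finset.sum_nonneg fun w _ => h _) (by positivity)

theorem abs_En_le (n : ℕ) (f : ℤ × ℤ → ℝ) : |En n f| ≤ En n (fun z => |f z|) := by
  unfold En
  rw [abs_div, abs_of_pos (by positivity : (0:ℝ) < 4 ^ n)]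
  gcongr
  exact Finset.abs_sum_le_sum_abs _ _

theorem En_tendsto {α : Type*} {l : Filter α} (n : ℕ) {f : α → ℤ × ℤ → ℝ} {g : ℤ × ℤ → ℝ}
    (h : ∀ z, Tendsto (fun a => f a z) l (nhds (g z))) :
    Tendsto (fun a => En n (f a)) l (nhds (En n g)) := by
  unfold En
  exact (tendsto_finsetSum _ (fun w _ => h _)).div_const _

/-- the expectation of `f` at the hitting point of the half-line, at time `n+1` -/
noncomputable def hn (n : ℕ) (f : ℤ × ℤ → ℝ) : ℝ := En n (stepAvg (slitH.indicator f))

theorem stepAvg_mono {f g : ℤ × ℤ → ℝ} (h : ∀ z, f z ≤ g z) (z) : stepAvg f z ≤ stepAvg g z := by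
  unfold stepAvg
  linarith [h (z.1+1, z.2), h (z.1-1, z.2), h (z.1, z.2+1), h (z.1, z.2-1)]

theorem En_succ' (n : ℕ) (f : ℤ × ℤ → ℝ) : En (n+1) f = En n (stepAvg f) - hn n f := by
  rw [En_succ, hn, ← En_sub]
  congr 1
  funext z
  have : ∀ z, f z = slitH.indicator f z + slitHᶜ.indicator f z := by
    intro z
    exact (congrFun (Set.indicator_self_add_compl slitH f) z).symm
  simp only [stepAvg]
  rw [this (z.1+1, z.2), this (z.1-1, z.2), this (z.1, z.2+1), this (z.1, z.2-1)]
  ring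

theorem hn_congr (n : ℕ) {f g : ℤ × ℤ → ℝ} (h : ∀ z ∈ slitH, f z = g z) : hn n f = hn n g := by
  unfold hn
  rw [Set.indicator_congr h]

theorem hn_mono (n : ℕ) {f g : ℤ × ℤ → ℝ} (h : ∀ z ∈ slitH, f z ≤ g z) : hn n f ≤ hn n g := by
  unfold hn
  apply En_mono
  apply stepAvg_mono
  intro z
  by_cases hz : z ∈ slitH
  · simpa [hz] using h z hz
  · simp [hz]

theorem hn_nonneg (n : ℕ) {f : ℤ × ℤ → ℝ} (h : ∀ z ∈ slitH, 0 ≤ f z) : 0 ≤ hn n f := by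
  have := hn_mono (f := fun _ => 0) (g := f) n h
  refine le_trans (le_of_eq ?_) this
  simp [hn, stepAvg, En]

theorem stepAvg_add (f g : ℤ × ℤ → ℝ) (z) :
    stepAvg (fun z => f z + g z) z = stepAvg f z + stepAvg g z := by
  unfold stepAvg; ring

theorem stepAvg_smul (c : ℝ) (f : ℤ × ℤ → ℝ) (z) :
    stepAvg (fun z => c * f z) z = c * stepAvg f z := by
  unfold stepAvg; ring

theorem hn_add (n : ℕ) (f g : ℤ × ℤ → ℝ) : hn n (fun z => f z + g z) = hn n f + hn n g := by
  unfold hn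
  rw [← En_add]
  congr 1
  funext z
  rw [← stepAvg_add]
  congr 1
  funext z
  exact congrFun (Set.indicator_add slitH f g) z

theorem hn_smul (n : ℕ) (c : ℝ) (f : ℤ × ℤ → ℝ) : hn n (fun z => c * f z) = c * hn n f := by
  unfold hn
  rw [← En_smul]
  congr 1
  funext z
  rw [← stepAvg_smul]
  congr 1
  funext z
  by_cases hz : z ∈ slitH <;> simp [hz]

theorem hn_tendsto {α : Type*} {l : Filter α} (n : ℕ) {f : α → ℤ × ℤ → ℝ} {g : ℤ × ℤ → ℝ}
    (h : ∀ z ∈ slitH, Tendsto (fun a => f a z) l (nhds (g z))) :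
    Tendsto (fun a => hn n (f a)) l (nhds (hn n g)) := by
  unfold hn
  apply En_tendsto
  have h' : ∀ z, Tendsto (fun a => slitH.indicator (f a) z) l (nhds (slitH.indicator g z)) := by
    intro z
    by_cases hz : z ∈ slitH
    · simpa [hz] using h z hz
    · simpa [hz] using tendsto_const_nhds
  intro z
  unfold stepAvg
  exact ((((h' _).add (h' _)).add (h' _)).add (h' _)).div_const _

/-- for `n ≥ 1` the expectation only sees values off the half-line -/
theorem En_congr (n : ℕ) {f g : ℤ × ℤ → ℝ} (h : ∀ z ∉ slitH, f z = g z) :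
    En (n+1) f = En (n+1) g := by
  rw [En_succ, En_succ, Set.indicator_congr (s := slitHᶜ) h]

theorem walk_bound : ∀ (n : ℕ) (w : Walk n), |w.last.1| ≤ n ∧ |w.last.2| ≤ n
  | 0, w => by
    have : w.last = (0,0) := w.2.1
    simp [this]
  | n+1, w => by
    obtain ⟨h1, h2⟩ := walk_bound n (walkEquiv n w).1
    have h3 := (walkEquiv n w).2.2.1
    rw [walkEquiv_last]
    generalize hp : walkEquiv n w = p at *
    obtain ⟨p1, p2, hp2⟩ := p
    simp only at h1 h2 h3 ⊢
    clear hp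
    generalize p1.last = z at *
    rw [abs_le] at h1 h2
    simp only [sqSteps, Set.mem_insert_iff, Set.mem_singleton_iff] at h3
    push_cast
    rcases h3 with rfl | rfl | rfl | rfl <;> simp [abs_le] <;> omega

theorem En_one_le (n : ℕ) : En n (fun _ => 1) ≤ 1 := by
  induction n with
  | zero => rw [En_zero]
  | succ n ih =>
    rw [En_succ']
    have h : stepAvg (fun _ => (1:ℝ)) = fun _ => 1 := by funext z; simp [stepAvg]; norm_num
    rw [h]
    linarith [hn_nonneg n (f := fun _ => 1) (fun _ _ => zero_le_one)]

theorem En_bound (n : ℕ) {f : ℤ × ℤ → ℝ} {M : ℝ} (hM : 0 ≤ M)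
    (h : ∀ z : ℤ × ℤ, |z.1| ≤ n → |z.2| ≤ n → |f z| ≤ M) : |En n f| ≤ M := by
  refine (abs_En_le n f).trans ?_
  have : En n (fun z => |f z|) ≤ En n (fun _ => M * 1) := by
    unfold En
    gcongr with w
    obtain ⟨h1, h2⟩ := walk_bound n w
    simpa using h _ h1 h2
  refine this.trans ?_
  rw [En_smul]
  nlinarith [En_one_le n]

theorem En_reflect (n : ℕ) (f : ℤ × ℤ → ℝ) : En n (fun z => f (z.1, -z.2)) = En n f := by
  induction n generalizing f with
  | zero => simp [En_zero]
  | succ n ih =>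
    rw [En_succ, En_succ, ← ih]
    congr 1
    funext z
    have : ∀ z : ℤ × ℤ, slitHᶜ.indicator (fun z => f (z.1, -z.2)) z
        = slitHᶜ.indicator f (z.1, -z.2) := by
      intro z
      by_cases hz : z ∈ slitH
      · have : (z.1, -z.2) ∈ slitH := by simpa [slitH] using hz
        simp [hz, this]
      · have : (z.1, -z.2) ∉ slitH := by simpa [slitH] using hz
        simp [hz, this]
    simp only [stepAvg, this]
    have e1 : -(-z.2 + 1) = z.2 - 1 := by ring
    have e2 : -(-z.2 - 1) = z.2 + 1 := by ring
    rw [e1, e2, neg_neg]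
    ring

theorem En_y (n : ℕ) : En n (fun z => (z.2 : ℝ)) = 0 := by
  have := En_reflect n (fun z => (z.2 : ℝ))
  have h2 : En n (fun z => (-1 : ℝ) * (z.2 : ℝ)) = -1 * En n (fun z => (z.2 : ℝ)) :=
    En_smul _ _ _
  have h3 : (fun z : ℤ × ℤ => (((z.1, -z.2) : ℤ × ℤ).2 : ℝ)) = fun z => (-1 : ℝ) * (z.2 : ℝ) := by
    funext z; simp
  rw [h3] at this
  linarith

end SlitAux

namespace SlitAux

/-! ### Part B: generating functions and optional stopping -/

section GenFun
open Set Topology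

/-- weight controlling quadratic growth -/
noncomputable def wt (z : ℤ × ℤ) : ℝ := (1 + |(z.1:ℝ)| + |(z.2:ℝ)|)^2

/-- at most quadratic growth -/
def Gr (f : ℤ × ℤ → ℝ) : Prop := ∃ C : ℝ, 0 ≤ C ∧ ∀ z, |f z| ≤ C * wt z

theorem one_le_wt (z : ℤ × ℤ) : 1 ≤ wt z := by
  unfold wt
  nlinarith [abs_nonneg (z.1:ℝ), abs_nonneg (z.2:ℝ)]

theorem wt_le {z : ℤ × ℤ} {m : ℕ} (h1 : |z.1| ≤ m) (h2 : |z.2| ≤ m) : wt z ≤ (1 + 2 * (m:ℝ))^2 := by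
  have h1' : |(z.1:ℝ)| ≤ m := by exact_mod_cast h1
  have h2' : |(z.2:ℝ)| ≤ m := by exact_mod_cast h2
  unfold wt
  apply pow_le_pow_left₀ (by positivity)
  linarith

theorem wt_fst (z : ℤ × ℤ) (e : ℤ) (he : |(e:ℝ)| ≤ 1) : wt (z.1 + e, z.2) ≤ 4 * wt z := by
  unfold wt
  push_cast
  have := abs_add_le (z.1:ℝ) e
  have h := abs_nonneg (z.1:ℝ)
  have h' := abs_nonneg (z.2:ℝ)
  calc (1 + |(z.1:ℝ) + e| + |(z.2:ℝ)|)^2 ≤ (2 * (1 + |(z.1:ℝ)| + |(z.2:ℝ)|))^2 := by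
        apply pow_le_pow_left₀ (by positivity); linarith
    _ = _ := by ring

theorem wt_snd (z : ℤ × ℤ) (e : ℤ) (he : |(e:ℝ)| ≤ 1) : wt (z.1, z.2 + e) ≤ 4 * wt z := by
  unfold wt
  push_cast
  have := abs_add_le (z.2:ℝ) e
  have h := abs_nonneg (z.1:ℝ)
  have h' := abs_nonneg (z.2:ℝ)
  calc (1 + |(z.1:ℝ)| + |(z.2:ℝ) + e|)^2 ≤ (2 * (1 + |(z.1:ℝ)| + |(z.2:ℝ)|))^2 := by
        apply pow_le_pow_left₀ (by positivity); linarith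
    _ = _ := by ring

theorem stepAvg_bound {f : ℤ × ℤ → ℝ} {C : ℝ} (hC : 0 ≤ C) (h : ∀ z, |f z| ≤ C * wt z) (z : ℤ × ℤ) :
    |stepAvg f z| ≤ 4 * C * wt z := by
  have a1 := (h (z.1+1, z.2)).trans (mul_le_mul_of_nonneg_left (wt_fst z 1 (by simp)) hC)
  have a2 := (h (z.1-1, z.2)).trans (mul_le_mul_of_nonneg_left (wt_fst z (-1) (by simp)) hC)
  have a3 := (h (z.1, z.2+1)).trans (mul_le_mul_of_nonneg_left (wt_snd z 1 (by simp)) hC)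
  have a4 := (h (z.1, z.2-1)).trans (mul_le_mul_of_nonneg_left (wt_snd z (-1) (by simp)) hC)
  rw [abs_le] at *
  unfold stepAvg
  constructor <;> linarith [a1.1, a1.2, a2.1, a2.2, a3.1, a3.2, a4.1, a4.2]

theorem Gr.stepAvg {f : ℤ × ℤ → ℝ} (h : Gr f) : Gr (stepAvg f) := by
  obtain ⟨C, hC, h⟩ := h
  exact ⟨4 * C, by positivity, stepAvg_bound hC h⟩

theorem Gr.add {f g : ℤ × ℤ → ℝ} (hf : Gr f) (hg : Gr g) : Gr (fun z => f z + g z) := by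
  obtain ⟨C, hC, h⟩ := hf
  obtain ⟨D, hD, h'⟩ := hg
  refine ⟨C + D, by positivity, fun z => (abs_add_le _ _).trans ?_⟩
  rw [add_mul]; exact add_le_add (h z) (h' z)

theorem Gr.smul {f : ℤ × ℤ → ℝ} (c : ℝ) (hf : Gr f) : Gr (fun z => c * f z) := by
  obtain ⟨C, hC, h⟩ := hf
  refine ⟨|c| * C, by positivity, fun z => ?_⟩
  rw [abs_mul, mul_assoc]; exact mul_le_mul_of_nonneg_left (h z) (abs_nonneg c)

theorem Gr.sub {f g : ℤ × ℤ → ℝ} (hf : Gr f) (hg : Gr g) : Gr (fun z => f z - g z) := by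
  have := hf.add (hg.smul (-1))
  convert this using 2; ring

theorem Gr.of_bdd {f : ℤ × ℤ → ℝ} {C : ℝ} (h : ∀ z, |f z| ≤ C) : Gr f := by
  have hC : 0 ≤ C := (abs_nonneg _).trans (h (0,0))
  exact ⟨C, hC, fun z => (h z).trans (le_mul_of_one_le_right hC (one_le_wt z))⟩

theorem Gr.of_lin {f : ℤ × ℤ → ℝ} {C : ℝ} (h : ∀ z : ℤ × ℤ, |f z| ≤ C * (1 + |(z.1:ℝ)| + |(z.2:ℝ)|)) :
    Gr f := by
  have hC : 0 ≤ C := by simpa using (abs_nonneg _).trans (h (0,0))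
  refine ⟨C, hC, fun z => (h z).trans (mul_le_mul_of_nonneg_left ?_ hC)⟩
  unfold wt
  nlinarith [abs_nonneg (z.1:ℝ), abs_nonneg (z.2:ℝ)]

theorem gr_one : Gr (fun _ => 1) := Gr.of_bdd (C := 1) (by simp)

theorem En_growth (n : ℕ) {f : ℤ × ℤ → ℝ} {C : ℝ} (hC : 0 ≤ C) (h : ∀ z, |f z| ≤ C * wt z) :
    |En n f| ≤ C * (1 + 2 * (n:ℝ))^2 :=
  En_bound n (by positivity) fun z h1 h2 =>
    (h z).trans (mul_le_mul_of_nonneg_left (wt_le h1 h2) hC)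

theorem hn_growth (n : ℕ) {f : ℤ × ℤ → ℝ} {C : ℝ} (hC : 0 ≤ C) (h : ∀ z ∈ slitH, |f z| ≤ C * wt z) :
    |hn n f| ≤ 4 * C * (1 + 2 * (n:ℝ))^2 := by
  apply En_growth n (by positivity)
  apply stepAvg_bound hC
  intro z
  by_cases hz : z ∈ slitH
  · simpa [hz] using h z hz
  · simp only [hz, not_false_eq_true, indicator_of_notMem, abs_zero]
    have := one_le_wt z
    positivity

theorem summable_quad {t : ℝ} (h0 : 0 ≤ t) (h1 : t < 1) :
    Summable (fun n : ℕ => t^n * (1 + 2 * (n:ℝ))^2) := by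
  have hn : ‖t‖ < 1 := by rwa [Real.norm_eq_abs, abs_of_nonneg h0]
  have a0 := summable_pow_mul_geometric_of_norm_lt_one 0 hn
  have a1 := summable_pow_mul_geometric_of_norm_lt_one 1 hn
  have a2 := summable_pow_mul_geometric_of_norm_lt_one 2 hn
  refine ((a0.add (a1.mul_left 4)).add (a2.mul_left 4)).congr fun n => ?_
  simp; ring

theorem summable_G {t : ℝ} (h0 : 0 ≤ t) (h1 : t < 1) {f : ℤ × ℤ → ℝ} (hf : Gr f) :
    Summable (fun n : ℕ => t^n * En n f) := by
  obtain ⟨C, hC, h⟩ := hf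
  refine Summable.of_norm_bounded ((summable_quad h0 h1).mul_left C) fun n => ?_
  rw [Real.norm_eq_abs, abs_mul, abs_of_nonneg (pow_nonneg h0 n), ← mul_assoc, mul_comm C, mul_assoc]
  exact mul_le_mul_of_nonneg_left (En_growth n hC h) (pow_nonneg h0 n)

theorem summable_H {t : ℝ} (h0 : 0 ≤ t) (h1 : t < 1) {f : ℤ × ℤ → ℝ} (hf : Gr f) :
    Summable (fun n : ℕ => t^(n+1) * hn n f) := by
  obtain ⟨C, hC, h⟩ := hf
  refine Summable.of_norm_bounded ((summable_quad h0 h1).mul_left (4 * C)) fun n => ?_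
  rw [Real.norm_eq_abs, abs_mul, abs_of_nonneg (pow_nonneg h0 _)]
  calc t^(n+1) * |hn n f| ≤ t^n * (4 * C * (1 + 2 * (n:ℝ))^2) :=
        mul_le_mul (pow_le_pow_of_le_one h0 h1.le (Nat.le_succ n)) (hn_growth n hC fun z _ => h z)
          (abs_nonneg _) (pow_nonneg h0 n)
    _ = _ := by ring

/-- generating function of the expectations -/
noncomputable def Gt (t : ℝ) (f : ℤ × ℤ → ℝ) : ℝ := ∑' n : ℕ, t^n * En n f

/-- generating function of the hitting expectations -/
noncomputable def Hs (t : ℝ) (f : ℤ × ℤ → ℝ) : ℝ := ∑' n : ℕ, t^(n+1) * hn n f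

theorem Gt_add {t : ℝ} (h0 : 0 ≤ t) (h1 : t < 1) {f g : ℤ × ℤ → ℝ} (hf : Gr f) (hg : Gr g) :
    Gt t (fun z => f z + g z) = Gt t f + Gt t g := by
  unfold Gt
  rw [← (summable_G h0 h1 hf).tsum_add (summable_G h0 h1 hg)]
  simp_rw [En_add, mul_add]

theorem Gt_smul (t c : ℝ) (f : ℤ × ℤ → ℝ) : Gt t (fun z => c * f z) = c * Gt t f := by
  unfold Gt
  rw [← tsum_mul_left]
  simp_rw [En_smul]
  congr 1; funext n; ring

theorem Gt_sub {t : ℝ} (h0 : 0 ≤ t) (h1 : t < 1) {f g : ℤ × ℤ → ℝ} (hf : Gr f) (hg : Gr g) :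
    Gt t (fun z => f z - g z) = Gt t f - Gt t g := by
  unfold Gt
  rw [← (summable_G h0 h1 hf).tsum_sub (summable_G h0 h1 hg)]
  simp_rw [En_sub, mul_sub]

theorem Gt_mono {t : ℝ} (h0 : 0 ≤ t) (h1 : t < 1) {f g : ℤ × ℤ → ℝ} (hf : Gr f) (hg : Gr g)
    (h : ∀ z, f z ≤ g z) : Gt t f ≤ Gt t g :=
  (summable_G h0 h1 hf).tsum_le_tsum
    (fun n => mul_le_mul_of_nonneg_left (En_mono n h) (pow_nonneg h0 n)) (summable_G h0 h1 hg)

theorem Gt_abs_le {t : ℝ} (h0 : 0 ≤ t) (h1 : t < 1) {f : ℤ × ℤ → ℝ} {C : ℝ}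
    (h : ∀ z, |f z| ≤ C) : |Gt t f| ≤ C * Gt t (fun _ => 1) := by
  have hf : Gr f := Gr.of_bdd h
  rw [← Gt_smul, abs_le]
  constructor
  · have := Gt_mono h0 h1 ((gr_one.smul C).smul (-1)) hf (fun z => by linarith [(abs_le.1 (h z)).1])
    rw [Gt_smul] at this
    linarith
  · exact Gt_mono h0 h1 hf (gr_one.smul C) (fun z => by linarith [(abs_le.1 (h z)).2])

theorem Hs_add {t : ℝ} (h0 : 0 ≤ t) (h1 : t < 1) {f g : ℤ × ℤ → ℝ} (hf : Gr f) (hg : Gr g) :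
    Hs t (fun z => f z + g z) = Hs t f + Hs t g := by
  unfold Hs
  rw [← (summable_H h0 h1 hf).tsum_add (summable_H h0 h1 hg)]
  simp_rw [hn_add, mul_add]

theorem Hs_smul (t c : ℝ) (f : ℤ × ℤ → ℝ) : Hs t (fun z => c * f z) = c * Hs t f := by
  unfold Hs
  rw [← tsum_mul_left]
  simp_rw [hn_smul]
  congr 1; funext n; ring

theorem Hs_congr (t : ℝ) {f g : ℤ × ℤ → ℝ} (h : ∀ z ∈ slitH, f z = g z) : Hs t f = Hs t g := by
  unfold Hs
  simp_rw [fun n => hn_congr n h]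

theorem Hs_tendsto {α : Type*} {l : Filter α} {t : ℝ} (h0 : 0 ≤ t)
    (h1 : t < 1) {f : α → ℤ × ℤ → ℝ} {g : ℤ × ℤ → ℝ} {C : ℝ} (hC : 0 ≤ C)
    (hb : ∀ᶠ a in l, ∀ z ∈ slitH, |f a z| ≤ C * wt z)
    (h : ∀ z ∈ slitH, Tendsto (fun a => f a z) l (𝓝 (g z))) :
    Tendsto (fun a => Hs t (f a)) l (𝓝 (Hs t g)) := by
  unfold Hs
  refine tendsto_tsum_of_dominated_convergence ((summable_quad h0 h1).mul_left (4 * C))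
    (fun n => (hn_tendsto n h).const_mul _) ?_
  filter_upwards [hb] with a ha n
  rw [Real.norm_eq_abs, abs_mul, abs_of_nonneg (pow_nonneg h0 _)]
  calc t^(n+1) * |hn n (f a)| ≤ t^n * (4 * C * (1 + 2 * (n:ℝ))^2) :=
        mul_le_mul (pow_le_pow_of_le_one h0 h1.le (Nat.le_succ n)) (hn_growth n hC ha)
          (abs_nonneg _) (pow_nonneg h0 n)
    _ = _ := by ring

/-- optional stopping -/
theorem stop_id {t : ℝ} (h0 : 0 ≤ t) (h1 : t < 1) {f : ℤ × ℤ → ℝ} (hf : Gr f) :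
    Gt t (fun z => f z - t * stepAvg f z) = f (0,0) - Hs t f := by
  have hG := summable_G h0 h1 hf
  have hP := summable_G h0 h1 hf.stepAvg
  have hH := summable_H h0 h1 hf
  rw [Gt_sub h0 h1 hf (hf.stepAvg.smul t), Gt_smul]
  have e1 : Gt t f = f (0,0) + ∑' n : ℕ, t^(n+1) * En (n+1) f := by
    unfold Gt
    rw [hG.tsum_eq_zero_add]; simp [En_zero]
  have e2 : t * Gt t (stepAvg f) = ∑' n : ℕ, t^(n+1) * En (n+1) f + Hs t f := by
    unfold Gt Hs
    rw [← ((summable_nat_add_iff 1).2 hG).tsum_add hH, ← tsum_mul_left]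
    congr 1; funext n
    rw [En_succ']; ring
  rw [e1, e2]; ring

end GenFun

end SlitAux

namespace SlitAux

/-! ### Part C: Wiener-Hopf factorisation -/

section WH
open Set Topology Real Metric

/-- the Wiener-Hopf factor -/
noncomputable def bet (C D : ℝ) (w : ℂ) : ℂ :=
  (1 - C * w) ^ (1/2 : ℂ) * (1 - D * w) ^ (1/2 : ℂ)

theorem slit_mem {C : ℝ} (h0 : 0 ≤ C) (h1 : C < 1) {w : ℂ} (hw : ‖w‖ ≤ 1) :
    1 - C * w ∈ Complex.slitPlane := by
  left
  have h2 := (abs_le.1 (Complex.abs_re_le_norm w)).2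
  simp only [Complex.sub_re, Complex.one_re, Complex.mul_re, Complex.ofReal_re, Complex.ofReal_im]
  nlinarith

theorem bet_ne {C D : ℝ} (h0 : 0 ≤ C) (h1 : C < 1) (h2 : 0 ≤ D) (h3 : D < 1) {w : ℂ} (hw : ‖w‖ ≤ 1) :
    bet C D w ≠ 0 := by
  unfold bet
  apply mul_ne_zero <;> rw [Ne, Complex.cpow_eq_zero_iff] <;> intro h
  · exact Complex.slitPlane_ne_zero (slit_mem h0 h1 hw) h.1
  · exact Complex.slitPlane_ne_zero (slit_mem h2 h3 hw) h.1

theorem half_sq (z : ℂ) : (z ^ (1/2:ℂ))^2 = z := by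
  rw [one_div]; exact Complex.cpow_nat_inv_pow z two_ne_zero

theorem bet_norm (C D : ℝ) (w : ℂ) : (‖bet C D w‖^2)^2 = Complex.normSq (1 - C * w) * Complex.normSq (1 - D * w) := by
  have : (bet C D w)^2 = (1 - C * w) * (1 - D * w) := by
    unfold bet; rw [mul_pow, half_sq, half_sq]
  rw [← norm_pow, this, norm_mul, mul_pow, Complex.sq_norm, Complex.sq_norm]

theorem bet_diff {C D : ℝ} (h0 : 0 ≤ C) (h1 : C < 1) (h2 : 0 ≤ D) (h3 : D < 1) {w : ℂ} (hw : ‖w‖ ≤ 1) :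
    DifferentiableAt ℂ (bet C D) w := by
  unfold bet
  apply DifferentiableAt.mul
  · exact DifferentiableAt.cpow (by fun_prop) (by fun_prop) (slit_mem h0 h1 hw)
  · exact DifferentiableAt.cpow (by fun_prop) (by fun_prop) (slit_mem h2 h3 hw)

theorem half_real {y : ℝ} (hy : 0 ≤ y) : (y:ℂ) ^ (1/2:ℂ) = (Real.sqrt y : ℝ) := by
  rw [Real.sqrt_eq_rpow, Complex.ofReal_cpow hy]; simp

theorem bet_real {C D x : ℝ} (h0 : 0 ≤ 1 - C * x) (h1 : 0 ≤ 1 - D * x) :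
    bet C D (x:ℂ) = ((Real.sqrt (1 - C * x) * Real.sqrt (1 - D * x) : ℝ) : ℂ) := by
  unfold bet
  rw [show (1:ℂ) - C * x = ((1 - C * x : ℝ) : ℂ) by push_cast; ring,
    show (1:ℂ) - D * x = ((1 - D * x : ℝ) : ℂ) by push_cast; ring, half_real h0, half_real h1]
  push_cast; ring

/-- real part of the Fourier kernel -/
noncomputable def kap (C D x : ℝ) (k : ℤ) (w : ℂ) : ℝ :=
  (bet C D x * (w ^ (-k) * (w / (bet C D w * (w - x))))).re

/-- transversal decay factor -/
noncomputable def rh (t C D : ℝ) (w : ℂ) : ℝ :=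
  ((1 - t/2 * w.re) - ‖bet C D w‖^2 / ((1 + C) * (1 - D))) / (t/2)

/-- the barrier function -/
noncomputable def vv (t C D x : ℝ) (z : ℤ × ℤ) : ℝ :=
  circleAverage (fun w => rh t C D w ^ z.2.natAbs * kap C D x z.1 w) 0 1

structure WHP (t C D x : ℝ) : Prop where
  t0 : 0 < t
  t1 : t < 1
  C0 : 0 ≤ C
  C1 : C < 1
  D0 : 0 ≤ D
  D1 : D < 1
  hC : 4 * C = t * (1 + C)^2
  hD : 4 * D = t * (1 - D)^2
  x0 : 0 ≤ x
  x1 : x < 1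

variable {t C D x : ℝ}

theorem sub_ne (h : WHP t C D x) {w : ℂ} (hw : ‖w‖ = 1) : w - x ≠ 0 := by
  intro h'
  rw [sub_eq_zero] at h'
  rw [h', Complex.norm_real, Real.norm_eq_abs, abs_of_nonneg h.x0] at hw
  linarith [h.x1]

theorem ne0 {w : ℂ} (hw : ‖w‖ = 1) : w ≠ 0 := by
  intro h; simp [h] at hw

theorem cont_bet (h : WHP t C D x) : ContinuousOn (bet C D) (sphere 0 1) := fun w hw =>
  (bet_diff h.C0 h.C1 h.D0 h.D1 (by simpa using (mem_sphere_zero_iff_norm.1 hw).le)).continuousAt.continuousWithinAt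

theorem cont_ker (h : WHP t C D x) (k : ℤ) : ContinuousOn
    (fun w => bet C D x * (w ^ (-k) * (w / (bet C D w * (w - x))))) (sphere 0 1) := by
  apply continuousOn_const.mul
  apply ContinuousOn.mul
  · exact continuousOn_id.zpow₀ _ (fun w hw => Or.inl (ne0 (mem_sphere_zero_iff_norm.1 hw)))
  · apply continuousOn_id.div
    · exact (cont_bet h).mul (by fun_prop)
    · intro w hw
      have hw' := mem_sphere_zero_iff_norm.1 hw
      exact mul_ne_zero (bet_ne h.C0 h.C1 h.D0 h.D1 hw'.le) (sub_ne h hw')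

theorem cont_kap (h : WHP t C D x) (k : ℤ) : ContinuousOn (kap C D x k) (sphere 0 1) :=
  Complex.continuous_re.comp_continuousOn (cont_ker h k)

theorem cont_rh (h : WHP t C D x) : ContinuousOn (rh t C D) (sphere 0 1) := by
  unfold rh
  apply ContinuousOn.div_const
  apply ContinuousOn.sub
  · exact Continuous.continuousOn (by fun_prop)
  · exact ((cont_bet h).norm.pow 2).div_const _

theorem s_sq (h : WHP t C D x) {w : ℂ} (hw : ‖w‖ = 1) :
    (‖bet C D w‖^2 / ((1 + C) * (1 - D)))^2 = (1 - t/2 * w.re)^2 - (t/2)^2 := by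
  have hn : w.re^2 + w.im^2 = 1 := by
    have := Complex.sq_norm w
    rw [hw, Complex.normSq_apply] at this; nlinarith
  have n1 : Complex.normSq (1 - C * w) = 1 - 2 * C * w.re + C^2 := by
    rw [Complex.normSq_apply]; simp; linear_combination C^2 * hn
  have n2 : Complex.normSq (1 - D * w) = 1 - 2 * D * w.re + D^2 := by
    rw [Complex.normSq_apply]; simp; linear_combination D^2 * hn
  rw [div_pow, bet_norm, n1, n2]
  have p1 : 0 < 1 + C := by linarith [h.C0]
  have p2 : 0 < 1 - D := by linarith [h.D1]
  have e1 : 1 - 2 * C * w.re + C^2 = (1 + C)^2 * (1 - t/2 * w.re - t/2) := by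
    linear_combination (- w.re/2 - 1/2) * h.hC
  have e2 : 1 - 2 * D * w.re + D^2 = (1 - D)^2 * (1 - t/2 * w.re + t/2) := by
    linear_combination (- w.re/2 + 1/2) * h.hD
  rw [e1, e2]
  field_simp
  ring

theorem rh_quad (h : WHP t C D x) {w : ℂ} (hw : ‖w‖ = 1) :
    t/4 * (rh t C D w^2 + 1) = (1 - t/2 * w.re) * rh t C D w := by
  have := s_sq h hw
  have ht := h.t0.ne'
  unfold rh
  generalize ‖bet C D w‖^2 / ((1 + C) * (1 - D)) = s at *
  field_simp
  linear_combination 8 * this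

theorem rh_mem (h : WHP t C D x) {w : ℂ} (hw : ‖w‖ = 1) : |rh t C D w| ≤ 1 := by
  have h1 := s_sq h hw
  have h2 := abs_le.1 (Complex.abs_re_le_norm w)
  rw [hw] at h2
  have ht := h.t0
  have ht1 := h.t1
  have hs : 0 ≤ ‖bet C D w‖^2 / ((1 + C) * (1 - D)) := by
    have p1 : 0 < 1 + C := by linarith [h.C0]
    have p2 : 0 < 1 - D := by linarith [h.D1]
    positivity
  unfold rh
  generalize ‖bet C D w‖^2 / ((1 + C) * (1 - D)) = s at *
  have ha : t/2 ≤ 1 - t/2 * w.re := by nlinarith [h2.2]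
  generalize 1 - t/2 * w.re = a at *
  rw [abs_div, abs_of_pos (by linarith : 0 < t/2), div_le_one (by linarith), abs_le]
  constructor <;> nlinarith

theorem kap_rec (k : ℤ) {w : ℂ} (hw : ‖w‖ = 1) :
    kap C D x (k+1) w + kap C D x (k-1) w = 2 * w.re * kap C D x k w := by
  have hw0 := ne0 hw
  unfold kap
  rw [← Complex.add_re, show 2 * w.re * (bet C D x * (w ^ (-k) * (w / (bet C D w * (w - x))))).re
    = (((2 * w.re : ℝ) : ℂ) * (bet C D x * (w ^ (-k) * (w / (bet C D w * (w - x)))))).re by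
      rw [Complex.re_ofReal_mul]]
  congr 1
  have e : ((2 * w.re : ℝ) : ℂ) = w + w⁻¹ := by
    rw [Complex.inv_def, Complex.normSq_eq_norm_sq, hw]
    simp [Complex.add_conj]
  rw [e, show -(k+1) = -k - 1 by ring, show -(k-1) = -k + 1 by ring, zpow_sub_one₀ hw0,
    zpow_add_one₀ hw0]
  ring

theorem vv_int (h : WHP t C D x) (z : ℤ × ℤ) : CircleIntegrable
    (fun w => rh t C D w ^ z.2.natAbs * kap C D x z.1 w) 0 1 := by
  apply ContinuousOn.circleIntegrable zero_le_one
  exact ((cont_rh h).pow _).mul (cont_kap h _)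

theorem vv_bdd (h : WHP t C D x) : ∃ M, ∀ z, |vv t C D x z| ≤ M := by
  obtain ⟨M, hM⟩ := (isCompact_sphere (0:ℂ) 1).exists_bound_of_continuousOn (cont_ker h 0)
  refine ⟨M, fun z => ?_⟩
  have key : ∀ w ∈ sphere (0:ℂ) |1|, |rh t C D w ^ z.2.natAbs * kap C D x z.1 w| ≤ M := by
    intro w hw
    rw [abs_one] at hw
    have hw' := mem_sphere_zero_iff_norm.1 hw
    have h1 := hM w hw
    rw [abs_mul, abs_pow]
    have h2 : |rh t C D w| ^ z.2.natAbs ≤ 1 := pow_le_one₀ (abs_nonneg _) (rh_mem h hw')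
    have h3 : |kap C D x z.1 w| ≤ M := by
      refine (Complex.abs_re_le_norm _).trans (le_trans (le_of_eq ?_) h1)
      simp only [norm_mul, norm_zpow, hw', one_zpow]
    calc _ ≤ 1 * M := mul_le_mul h2 h3 (abs_nonneg _) zero_le_one
      _ = M := one_mul M
  refine abs_circleAverage_le_circleAverage_abs.trans ?_
  exact circleAverage_mono_on_of_le_circle (vv_int h z).abs key

/-- combination under the integral -/
theorem vv_lap (h : WHP t C D x) (z : ℤ × ℤ) :
    vv t C D x z - t * stepAvg (vv t C D x) z = circleAverage (fun w =>
      (rh t C D w ^ z.2.natAbs * (1 - t/2 * w.re) - t/4 * (rh t C D w ^ (z.2+1).natAbs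
        + rh t C D w ^ (z.2-1).natAbs)) * kap C D x z.1 w) 0 1 := by
  have i0 := vv_int h z
  have i1 := vv_int h (z.1+1, z.2)
  have i2 := vv_int h (z.1-1, z.2)
  have i3 := vv_int h (z.1, z.2+1)
  have i4 := vv_int h (z.1, z.2-1)
  have e : vv t C D x z - t * stepAvg (vv t C D x) z =
      vv t C D x z - (t/4) • (vv t C D x (z.1+1, z.2) + vv t C D x (z.1-1, z.2)
        + vv t C D x (z.1, z.2+1) + vv t C D x (z.1, z.2-1)) := by
    unfold stepAvg; simp only [smul_eq_mul]; ring
  rw [e]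
  unfold vv
  rw [← circleAverage_add i1 i2, ← circleAverage_add (i1.add i2) i3,
    ← circleAverage_add ((i1.add i2).add i3) i4, ← circleAverage_smul,
    ← circleAverage_sub i0 ((((i1.add i2).add i3).add i4).const_smul)]
  apply circleAverage_congr_sphere
  intro w hw
  rw [abs_one] at hw
  have hw' := mem_sphere_zero_iff_norm.1 hw
  have := kap_rec (C := C) (D := D) (x := x) z.1 hw'
  simp only [Pi.sub_apply, Pi.smul_apply, Pi.add_apply, smul_eq_mul]
  linear_combination (-t/4 * rh t C D w ^ z.2.natAbs) * this

theorem vv_off (h : WHP t C D x) (z : ℤ × ℤ) (hz : z.2 ≠ 0) :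
    vv t C D x z - t * stepAvg (vv t C D x) z = 0 := by
  rw [vv_lap h]
  apply circleAverage_const_on_circle
  intro w hw
  rw [abs_one] at hw
  have hw' := mem_sphere_zero_iff_norm.1 hw
  have hq := rh_quad h hw'
  have : rh t C D w ^ (z.2+1).natAbs + rh t C D w ^ (z.2-1).natAbs
      = rh t C D w ^ (z.2.natAbs - 1) * (rh t C D w^2 + 1) ∧
      rh t C D w ^ z.2.natAbs = rh t C D w ^ (z.2.natAbs - 1) * rh t C D w := by
    constructor
    · rcases lt_or_gt_of_ne hz with h1 | h1
      · rw [show (z.2+1).natAbs = z.2.natAbs - 1 by omega,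
          show (z.2-1).natAbs = z.2.natAbs - 1 + 2 by omega]; ring
      · rw [show (z.2-1).natAbs = z.2.natAbs - 1 by omega,
          show (z.2+1).natAbs = z.2.natAbs - 1 + 2 by omega]; ring
    · rw [← pow_succ]; congr 1; omega
  rw [this.1, this.2]
  linear_combination (-(rh t C D w ^ (z.2.natAbs - 1)) * kap C D x z.1 w) * hq

theorem bet_conj (w : ℂ) :
    (starRingEnd ℂ) (bet C D w) * bet C D w = ((‖bet C D w‖^2 : ℝ) : ℂ) := by
  rw [Complex.conj_mul']; push_cast; rfl

theorem vv_axis (h : WHP t C D x) (k : ℕ) :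
    vv t C D x (k, 0) - t * stepAvg (vv t C D x) (k, 0)
      = (√(1 - C * x) * √(1 - D * x) / ((1 + C) * (1 - D))) * (0:ℝ)^k := by
  rw [vv_lap h]
  have hx := h.x0
  have hx1 := h.x1
  have b1 : 0 ≤ 1 - C * x := by nlinarith [h.C0, h.C1]
  have b2 : 0 ≤ 1 - D * x := by nlinarith [h.D0, h.D1]
  set B := √(1 - C * x) * √(1 - D * x) with hB
  have hBx : bet C D x = ((B : ℝ) : ℂ) := bet_real b1 b2
  set F : ℂ → ℂ := fun w => ((B / ((1 + C) * (1 - D)) : ℝ) : ℂ) * (bet C D w * w^k / (1 - x * w)) with hF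
  have hden : ∀ w : ℂ, ‖w‖ ≤ 1 → 1 - x * w ≠ 0 := fun w hw =>
    Complex.slitPlane_ne_zero (slit_mem hx hx1 hw)
  have hFd : ∀ w : ℂ, ‖w‖ ≤ 1 → DifferentiableAt ℂ F w := by
    intro w hw
    have := bet_diff h.C0 h.C1 h.D0 h.D1 hw
    have hd := hden w hw
    simp only [hF]
    fun_prop (disch := assumption)
  have hDC : DiffContOnCl ℂ F (ball 0 |(1:ℝ)|) := by
    rw [abs_one]
    apply DifferentiableOn.diffContOnCl
    rw [closure_ball _ one_ne_zero]
    intro w hw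
    exact (hFd w (by simpa using hw)).differentiableWithinAt
  have hav := hDC.circleAverage
  have hci : CircleIntegrable F 0 1 := by
    apply ContinuousOn.circleIntegrable zero_le_one
    intro w hw
    exact (hFd w (mem_sphere_zero_iff_norm.1 hw).le).continuousAt.continuousWithinAt
  have hre := Complex.reCLM.circleAverage_comp_comm hci
  rw [hav] at hre
  have hF0 : Complex.reCLM (F 0) = B / ((1 + C) * (1 - D)) * (0:ℝ)^k := by
    simp only [hF, Complex.reCLM_apply, Complex.re_ofReal_mul]
    congr 1
    have : bet C D 0 = 1 := by simp [bet]
    rw [this]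
    rcases k with _ | k <;> simp
  rw [← hF0, ← hre]
  apply circleAverage_congr_sphere
  intro w hw
  rw [abs_one] at hw
  have hw' := mem_sphere_zero_iff_norm.1 hw
  have hw0 := ne0 hw'
  have ht := h.t0.ne'
  have e1 : (rh t C D w ^ (0:ℤ).natAbs * (1 - t/2 * w.re) - t/4 * (rh t C D w ^ ((0:ℤ)+1).natAbs
        + rh t C D w ^ ((0:ℤ)-1).natAbs)) = ‖bet C D w‖^2 / ((1 + C) * (1 - D)) := by
    simp [rh]
    field_simp
    ring
  simp only [e1]
  simp only [Function.comp, Complex.reCLM_apply]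
  unfold kap
  rw [hBx, ← Complex.re_ofReal_mul, ← Complex.conj_re (F w)]
  congr 1
  have hbn := bet_ne h.C0 h.C1 h.D0 h.D1 hw'.le
  have hsn := sub_ne h hw'
  have hcw : (starRingEnd ℂ) w = w⁻¹ := by
    rw [Complex.inv_def, Complex.normSq_eq_norm_sq, hw']; simp
  simp only [hF, map_mul, map_div₀, map_pow, map_sub, map_one, Complex.conj_ofReal, hcw]
  have hb := bet_conj (C := C) (D := D) w
  rw [Complex.ofReal_div, ← hb]
  rw [zpow_neg, zpow_natCast, inv_pow]
  have e2 : (1:ℂ) - x * w⁻¹ = (w - x) / w := by field_simp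
  rw [e2]
  push_cast
  have p1 : (1:ℂ) + C ≠ 0 := by
    have : 0 < 1 + C := by linarith [h.C0]
    exact_mod_cast this.ne'
  have p2 : (1:ℂ) - D ≠ 0 := by
    have : 0 < 1 - D := by linarith [h.D1]
    exact_mod_cast this.ne'
  field_simp

theorem vv_slit (h : WHP t C D x) (j : ℕ) : vv t C D x (-(j:ℤ), 0) = x^j := by
  have hx := h.x0
  have hx1 := h.x1
  set F : ℂ → ℂ := fun w => bet C D x * (w^j / bet C D w) with hF
  have hxn : ‖(x:ℂ)‖ < 1 := by
    rw [Complex.norm_real, Real.norm_eq_abs, abs_of_nonneg hx]; exact hx1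
  have hFd : ∀ w : ℂ, ‖w‖ ≤ 1 → DifferentiableAt ℂ F w := by
    intro w hw
    have := bet_diff h.C0 h.C1 h.D0 h.D1 hw
    have hd := bet_ne h.C0 h.C1 h.D0 h.D1 hw
    simp only [hF]
    fun_prop (disch := assumption)
  have hDC : DiffContOnCl ℂ F (ball 0 |(1:ℝ)|) := by
    rw [abs_one]
    apply DifferentiableOn.diffContOnCl
    rw [closure_ball _ one_ne_zero]
    intro w hw
    exact (hFd w (by simpa using hw)).differentiableWithinAt
  have hav := hDC.circleAverage_smul_div (w := (x:ℂ)) (by simpa using hxn)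
  have hci : CircleIntegrable (fun z => ((z - 0) / (z - x)) • F z) 0 1 := by
    apply ContinuousOn.circleIntegrable zero_le_one
    refine ContinuousOn.smul (f := fun z : ℂ => (z - 0) / (z - (x:ℂ))) (g := F) ?_ ?_
    · apply ContinuousOn.div (by fun_prop) (by fun_prop)
      intro w hw
      exact sub_ne h (mem_sphere_zero_iff_norm.1 hw)
    · intro w hw
      exact (hFd w (mem_sphere_zero_iff_norm.1 hw).le).continuousAt.continuousWithinAt
  have hre := Complex.reCLM.circleAverage_comp_comm hci
  rw [hav] at hre
  have hF0 : Complex.reCLM (F x) = x^j := by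
    simp only [hF, Complex.reCLM_apply]
    rw [mul_div_cancel₀ _ (bet_ne h.C0 h.C1 h.D0 h.D1 hxn.le), ← Complex.ofReal_pow, Complex.ofReal_re]
  rw [← hF0, ← hre]
  unfold vv
  apply circleAverage_congr_sphere
  intro w hw
  rw [abs_one] at hw
  have hw' := mem_sphere_zero_iff_norm.1 hw
  simp only [Int.natAbs_zero, pow_zero, one_mul, kap, Function.comp, Complex.reCLM_apply, neg_neg,
    zpow_natCast, hF, smul_eq_mul, sub_zero]
  congr 1
  have hbn := bet_ne h.C0 h.C1 h.D0 h.D1 hw'.le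
  have hsn := sub_ne h hw'
  field_simp

theorem wiener_hopf (h : WHP t C D x) :
    Hs t (fun z => x ^ z.1.natAbs) = 1 - √(1 - C * x) * √(1 - D * x) / ((1 + C) * (1 - D)) := by
  obtain ⟨M, hM⟩ := vv_bdd h
  have hG : Gr (vv t C D x) := Gr.of_bdd hM
  have hs := stop_id h.t0.le h.t1 hG
  have e1 : Hs t (vv t C D x) = Hs t (fun z => x ^ z.1.natAbs) := by
    apply Hs_congr
    rintro ⟨k, l⟩ ⟨h1, h2⟩
    simp only at h1 h2
    subst h1
    have := vv_slit h k.natAbs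
    rw [show -(k.natAbs : ℤ) = k by omega] at this
    exact this
  have e2 : vv t C D x (0,0) = 1 := by simpa using vv_slit h 0
  have e3 : Gt t (fun z => vv t C D x z - t * stepAvg (vv t C D x) z)
      = √(1 - C * x) * √(1 - D * x) / ((1 + C) * (1 - D)) := by
    unfold Gt
    rw [tsum_eq_single 0]
    · rw [En_zero, pow_zero, one_mul]
      simpa using vv_axis h 0
    · intro n hn
      obtain ⟨m, rfl⟩ := Nat.exists_eq_succ_of_ne_zero hn
      rw [Nat.succ_eq_add_one, En_congr m (g := fun _ => 0)]
      · simp [En]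
      · rintro ⟨k, l⟩ hz
        by_cases hl : l = 0
        · subst hl
          have hk : 0 < k := by
            by_contra hk
            exact hz ⟨rfl, not_lt.1 hk⟩
          obtain ⟨m, rfl⟩ := Int.eq_ofNat_of_zero_le hk.le
          have hm : m ≠ 0 := by rintro rfl; simp at hk
          have := vv_axis h m
          rw [zero_pow hm, mul_zero] at this
          exact this
        · exact vv_off h (k, l) hl
  rw [e3, e1, e2] at hs
  linarith

end WH

end SlitAux

namespace SlitAux

/-! ### Part D: moments of the hitting point -/

section Mom
open Set Topology Real

/-- `√(1+t)` -/
noncomputable def dl (ε : ℝ) : ℝ := √(2 - ε^2)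
/-- prefactor -/
noncomputable def mm (ε : ℝ) : ℝ := √((1 + ε) * (1 + dl ε)) / 4
/-- quadratic polynomial -/
noncomputable def RR (ε s : ℝ) : ℝ := (2 * ε + (1 - ε) * s) * (2 + (dl ε - 1) * s)
/-- one minus the hitting generating function -/
noncomputable def FF (ε s : ℝ) : ℝ := mm ε * √(RR ε s)
/-- linear coefficient -/
noncomputable def r1 (ε : ℝ) : ℝ := 2 * (1 - ε) + 2 * ε * (dl ε - 1)
/-- quadratic coefficient -/
noncomputable def r2 (ε : ℝ) : ℝ := (1 - ε) * (dl ε - 1)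
/-- first moment -/
noncomputable def MA (ε : ℝ) : ℝ := mm ε * (r1 ε / (2 * √(RR ε 0)))
/-- second moment -/
noncomputable def MB (ε : ℝ) : ℝ := MA ε - 2 * (mm ε * (r2 ε / (2 * √(RR ε 0)) - r1 ε^2 / (8 * √(RR ε 0)^3)))

theorem dl_gt {ε : ℝ} (h0 : 0 < ε) (h1 : ε < 1) : 1 < dl ε := by
  unfold dl
  rw [Real.lt_sqrt zero_le_one]; nlinarith

theorem dl_sq {ε : ℝ} (h0 : 0 < ε) (h1 : ε < 1) : dl ε^2 = 2 - ε^2 := by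
  unfold dl
  rw [Real.sq_sqrt]; nlinarith

theorem Hs_pow {ε x : ℝ} (h0 : 0 < ε) (h1 : ε < 1) (hx0 : 0 ≤ x) (hx1 : x < 1) :
    Hs (1 - ε^2) (fun z => x ^ z.1.natAbs) = 1 - FF ε (1 - x) := by
  have hd := dl_gt h0 h1
  have hd2 := dl_sq h0 h1
  have hw : WHP (1 - ε^2) ((1-ε)/(1+ε)) ((dl ε - 1)/(dl ε + 1)) x := by
    refine ⟨by nlinarith, by nlinarith, ?_, ?_, ?_, ?_, ?_, ?_, hx0, hx1⟩
    · exact div_nonneg (by linarith) (by linarith)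
    · rw [div_lt_one (by linarith)]; linarith
    · exact div_nonneg (by linarith) (by linarith)
    · rw [div_lt_one (by linarith)]; linarith
    · have : (1 + ε) ≠ 0 := by linarith
      field_simp; ring
    · have : (dl ε + 1) ≠ 0 := by linarith
      field_simp
      linear_combination 4 * hd2
  rw [wiener_hopf hw]
  congr 1
  unfold FF mm RR
  have p1 : 0 < 1 + ε := by linarith
  have p2 : 0 < 1 + dl ε := by linarith
  have e1 : 1 - (1-ε)/(1+ε) * x = (2 * ε + (1 - ε) * (1 - x)) / (1 + ε) := by field_simp; ring
  have e2 : 1 - (dl ε - 1)/(dl ε + 1) * x = (2 + (dl ε - 1) * (1 - x)) / (1 + dl ε) := by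
    rw [add_comm (dl ε) 1]; field_simp; ring
  have q1 : 0 ≤ 2 * ε + (1 - ε) * (1 - x) := by nlinarith
  have q2 : 0 ≤ 2 + (dl ε - 1) * (1 - x) := by nlinarith
  rw [e1, e2, Real.sqrt_div q1, Real.sqrt_div q2, Real.sqrt_mul p1.le, Real.sqrt_mul q1]
  have e3 : (1 + (1-ε)/(1+ε)) * (1 - (dl ε - 1)/(dl ε + 1)) = 4 / ((1 + ε) * (1 + dl ε)) := by
    rw [add_comm (dl ε) 1]; field_simp; ring
  rw [e3]
  rw [show 4 / ((1 + ε) * (1 + dl ε)) = 4 / (√(1 + ε)^2 * √(1 + dl ε)^2) by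
    rw [Real.sq_sqrt p1.le, Real.sq_sqrt p2.le]]
  have := Real.sqrt_pos.2 p1
  have := Real.sqrt_pos.2 p2
  field_simp

theorem RR_zero (ε : ℝ) : RR ε 0 = 4 * ε := by unfold RR; ring

theorem RR_eq (ε s : ℝ) : RR ε s = 4 * ε + r1 ε * s + r2 ε * s^2 := by unfold RR r1 r2; ring

theorem q_pos {ε : ℝ} (h0 : 0 < ε) : 0 < √(RR ε 0) := by
  rw [RR_zero]; positivity

theorem FF_cont (ε : ℝ) : Continuous (FF ε) := by
  unfold FF RR
  fun_prop

theorem FF_deriv {ε : ℝ} (h0 : 0 < ε) : HasDerivAt (FF ε) (MA ε) 0 := by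
  have h1 : HasDerivAt (RR ε) (r1 ε) 0 := by
    have : RR ε = fun s => 4 * ε + r1 ε * s + r2 ε * s^2 := by funext s; exact RR_eq ε s
    rw [this]
    have := (((hasDerivAt_id (0:ℝ)).const_mul (r1 ε)).const_add (4*ε)).add
      (((hasDerivAt_pow 2 (0:ℝ))).const_mul (r2 ε))
    simp at this
    exact this
  have h2 := h1.sqrt (by rw [RR_zero]; positivity)
  exact h2.const_mul (mm ε)

theorem FF_slope {ε : ℝ} (h0 : 0 < ε) :
    Tendsto (fun s => (FF ε s - FF ε 0) / s) (𝓝[>] 0) (𝓝 (MA ε)) := by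
  have := (FF_deriv h0).tendsto_slope_zero_right
  refine this.congr fun s => ?_
  rw [zero_add, smul_eq_mul]; ring

theorem FF_second {ε : ℝ} (h0 : 0 < ε) (h1 : ε < 1) :
    Tendsto (fun s => (FF ε s - FF ε 0 - MA ε * s) / s^2) (𝓝[>] 0)
      (𝓝 (mm ε * (r2 ε / (2 * √(RR ε 0)) - r1 ε^2 / (8 * √(RR ε 0)^3)))) := by
  have hd := dl_gt h0 h1
  set q := √(RR ε 0) with hq
  have hq0 : 0 < q := q_pos h0
  have hm : mm ε ≠ 0 := by
    unfold mm
    have : 0 < (1 + ε) * (1 + dl ε) := by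
      apply mul_pos <;> linarith
    have := Real.sqrt_pos.2 this
    positivity
  have a1 := FF_slope h0
  have hc : Tendsto (fun s : ℝ => √(RR ε s)) (𝓝[>] 0) (𝓝 q) := by
    have : Continuous (fun s : ℝ => √(RR ε s)) := by unfold RR; fun_prop
    exact (this.tendsto 0).mono_left nhdsWithin_le_nhds
  have hid : Tendsto (fun s : ℝ => s) (𝓝[>] 0) (𝓝 0) := tendsto_id.mono_left nhdsWithin_le_nhds
  have a2 : Tendsto (fun s => r2 ε / (2 * q) - (r1 ε + r2 ε * s)^2 / (8 * q^3)
      + ((FF ε s - FF ε 0) / s / mm ε)^2 * ((√(RR ε s) - q) * (√(RR ε s) + 3 * q) / (8 * q^3)))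
      (𝓝[>] 0) (𝓝 (r2 ε / (2 * q) - (r1 ε + r2 ε * 0)^2 / (8 * q^3)
      + (MA ε / mm ε)^2 * ((q - q) * (q + 3 * q) / (8 * q^3)))) := by
    apply Tendsto.add
    · apply Tendsto.const_sub
      exact ((((hid.const_mul _).const_add _).pow 2).div_const _)
    · exact ((a1.div_const _).pow 2).mul (((hc.sub_const q).mul (hc.add_const _)).div_const _)
  have a3 := a2.const_mul (mm ε)
  simp only [mul_zero, add_zero, sub_self, zero_mul, zero_div] at a3
  refine a3.congr' ?_
  filter_upwards [self_mem_nhdsWithin] with s hs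
  have hs0 : (0:ℝ) < s := hs
  have hR : 0 ≤ RR ε s := by
    unfold RR
    have : 0 ≤ (1 - ε) * s := by nlinarith
    have : 0 ≤ (dl ε - 1) * s := by nlinarith
    positivity
  have hp2 : √(RR ε s)^2 = q^2 + r1 ε * s + r2 ε * s^2 := by
    rw [Real.sq_sqrt hR, hq, Real.sq_sqrt (by rw [RR_zero]; positivity), RR_zero, RR_eq]
  unfold MA FF
  rw [← hq]
  generalize √(RR ε s) = p at *
  have e : (mm ε * p - mm ε * q) / s / mm ε = (p - q) / s := by field_simp
  rw [e]
  have e1 : r1 ε = (p^2 - q^2)/s - r2 ε * s := by field_simp; linarith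
  rw [e1]
  field_simp
  ring

theorem dom_bound {f : ℤ × ℤ → ℝ} (j : ℕ) (hj : j ≤ 2) (h : ∀ z, |f z| ≤ |(z.1:ℝ)|^j) (z) : |f z| ≤ 1 * wt z := by
  refine (h z).trans ?_
  unfold wt
  have a := abs_nonneg (z.1:ℝ)
  have b := abs_nonneg (z.2:ℝ)
  interval_cases j <;> nlinarith

theorem natAbs_cast (k : ℤ) : ((k.natAbs : ℕ) : ℝ) = |(k:ℝ)| := by
  rw [Nat.cast_natAbs]; simp

theorem geom_quot_tendsto (j : ℕ) : Tendsto (fun s : ℝ => (1 - (1-s)^j)/s) (𝓝[>] 0) (𝓝 j) := by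
  have h : HasDerivAt (fun s : ℝ => -(1-s)^j) j 0 := by
    have := (((hasDerivAt_id (0:ℝ)).const_sub 1).pow j).neg
    simp at this
    exact this
  have := h.tendsto_slope_zero_right
  refine this.congr fun s => ?_
  simp; ring

theorem geom_quot_le {s : ℝ} (h0 : 0 < s) (h1 : s < 1) (j : ℕ) : |(1 - (1-s)^j)/s| ≤ j := by
  have h2 : (1-s)^j ≤ 1 := pow_le_one₀ (by linarith) (by linarith)
  have h3 := one_add_mul_le_pow (a := -s) (by linarith) j
  rw [abs_of_nonneg (div_nonneg (by linarith) h0.le), div_le_iff₀ h0]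
  rw [show 1 + -s = 1 - s by ring] at h3
  linarith

theorem gr_pow {x : ℝ} (hx0 : 0 ≤ x) (hx1 : x ≤ 1) : Gr (fun z => x ^ z.1.natAbs) :=
  Gr.of_bdd (C := 1) fun z => by
    rw [abs_of_nonneg (pow_nonneg hx0 _)]; exact pow_le_one₀ hx0 hx1

theorem sub_mem {s : ℝ} (h : s ∈ Ioo (0:ℝ) 1) : 0 ≤ 1 - s ∧ 1 - s < 1 := ⟨by linarith [h.2], by linarith [h.1]⟩

theorem tt_mem {ε : ℝ} (h0 : 0 < ε) (h1 : ε < 1) : 0 ≤ 1 - ε^2 ∧ 1 - ε^2 < 1 :=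
  ⟨by nlinarith, by nlinarith⟩

theorem Hs_one {ε : ℝ} (h0 : 0 < ε) (h1 : ε < 1) : Hs (1 - ε^2) (fun _ => 1) = 1 - FF ε 0 := by
  have hm : Ioo (0:ℝ) 1 ∈ 𝓝[>] (0:ℝ) := Ioo_mem_nhdsGT zero_lt_one
  obtain ⟨t0, t1⟩ := tt_mem h0 h1
  have a1 : Tendsto (fun s : ℝ => Hs (1 - ε^2) (fun z => (1-s) ^ z.1.natAbs)) (𝓝[>] 0)
      (𝓝 (Hs (1 - ε^2) (fun _ => 1))) := by
    apply Hs_tendsto t0 t1 zero_le_one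
    · filter_upwards [hm] with s hs z _
      obtain ⟨u0, u1⟩ := sub_mem hs
      rw [abs_of_nonneg (pow_nonneg u0 _)]
      linarith [pow_le_one₀ u0 u1.le (n := z.1.natAbs), one_le_wt z]
    · intro z _
      have : Continuous (fun s : ℝ => (1-s)^z.1.natAbs) := by fun_prop
      have := (this.tendsto 0).mono_left (nhdsWithin_le_nhds (s := Ioi 0))
      simpa using this
  have a2 : Tendsto (fun s : ℝ => 1 - FF ε s) (𝓝[>] 0) (𝓝 (1 - FF ε 0)) :=
    (((FF_cont ε).tendsto 0).const_sub 1).mono_left nhdsWithin_le_nhds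
  refine tendsto_nhds_unique (a1.congr' ?_) a2
  filter_upwards [hm] with s hs
  obtain ⟨u0, u1⟩ := sub_mem hs
  rw [Hs_pow h0 h1 u0 u1, sub_sub_cancel]

theorem Hs_abs {ε : ℝ} (h0 : 0 < ε) (h1 : ε < 1) : Hs (1 - ε^2) (fun z => |(z.1:ℝ)|) = MA ε := by
  have hm : Ioo (0:ℝ) 1 ∈ 𝓝[>] (0:ℝ) := Ioo_mem_nhdsGT zero_lt_one
  obtain ⟨t0, t1⟩ := tt_mem h0 h1
  have a1 : Tendsto (fun s : ℝ => Hs (1 - ε^2) (fun z => (1 - (1-s) ^ z.1.natAbs)/s)) (𝓝[>] 0)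
      (𝓝 (Hs (1 - ε^2) (fun z => |(z.1:ℝ)|))) := by
    apply Hs_tendsto t0 t1 zero_le_one
    · filter_upwards [hm] with s hs z _
      refine dom_bound (f := fun z => (1 - (1-s) ^ z.1.natAbs)/s) 1 (by norm_num) (fun z => ?_) z
      rw [pow_one, ← natAbs_cast]
      exact geom_quot_le hs.1 hs.2 _
    · intro z _
      rw [← natAbs_cast]
      exact geom_quot_tendsto _
  refine tendsto_nhds_unique (a1.congr' ?_) (FF_slope h0)
  filter_upwards [hm] with s hs
  obtain ⟨u0, u1⟩ := sub_mem hs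
  have e : (fun z : ℤ × ℤ => (1 - (1-s) ^ z.1.natAbs)/s)
      = fun z => s⁻¹ * 1 + (-s⁻¹) * (1-s) ^ z.1.natAbs := by funext z; ring
  rw [e, Hs_add t0 t1 (gr_one.smul _) ((gr_pow u0 u1.le).smul _), Hs_smul, Hs_smul, Hs_one h0 h1,
    Hs_pow h0 h1 u0 u1, sub_sub_cancel]
  ring

theorem Hs_sq {ε : ℝ} (h0 : 0 < ε) (h1 : ε < 1) : Hs (1 - ε^2) (fun z => (z.1:ℝ)^2) = MB ε := by
  have hm : Ioo (0:ℝ) 1 ∈ 𝓝[>] (0:ℝ) := Ioo_mem_nhdsGT zero_lt_one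
  obtain ⟨t0, t1⟩ := tt_mem h0 h1
  have a1 : Tendsto (fun s : ℝ => Hs (1 - ε^2) (fun z => ((1 - (1-s) ^ z.1.natAbs)/s)^2)) (𝓝[>] 0)
      (𝓝 (Hs (1 - ε^2) (fun z => (z.1:ℝ)^2))) := by
    apply Hs_tendsto t0 t1 zero_le_one
    · filter_upwards [hm] with s hs z _
      refine dom_bound (f := fun z => ((1 - (1-s) ^ z.1.natAbs)/s)^2) 2 le_rfl (fun z => ?_) z
      rw [abs_pow, ← natAbs_cast]
      exact pow_le_pow_left₀ (abs_nonneg _) (geom_quot_le hs.1 hs.2 _) 2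
    · intro z _
      rw [← sq_abs, ← natAbs_cast]
      exact (geom_quot_tendsto _).pow 2
  have hQ := FF_second h0 h1
  have hid : Tendsto (fun s : ℝ => s) (𝓝[>] 0) (𝓝 0) := tendsto_id.mono_left nhdsWithin_le_nhds
  have hg : Tendsto (fun s : ℝ => 2 * s - s^2) (𝓝[>] 0) (𝓝[>] 0) := by
    apply tendsto_nhdsWithin_of_tendsto_nhds_of_eventually_within
    · have := (hid.const_mul 2).sub (hid.pow 2)
      simpa using this
    · filter_upwards [hm] with s hs
      have := hs.1
      have := hs.2
      change 0 < 2 * s - s^2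
      nlinarith
  have a2 := ((hQ.const_mul 2).sub ((hQ.comp hg).mul ((hid.const_sub 2).pow 2))).const_add (MA ε)
  have e : MA ε + (2 * (mm ε * (r2 ε / (2 * √(RR ε 0)) - r1 ε^2 / (8 * √(RR ε 0)^3)))
     - (mm ε * (r2 ε / (2 * √(RR ε 0)) - r1 ε^2 / (8 * √(RR ε 0)^3))) * (2 - 0)^2) = MB ε := by
    unfold MB; ring
  rw [e] at a2
  refine tendsto_nhds_unique (a1.congr' ?_) a2
  filter_upwards [hm] with s hs
  obtain ⟨u0, u1⟩ := sub_mem hs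
  have e : (fun z : ℤ × ℤ => ((1 - (1-s) ^ z.1.natAbs)/s)^2)
      = fun z => ((s^2)⁻¹ * 1 + (-2 * (s^2)⁻¹) * (1-s) ^ z.1.natAbs)
        + (s^2)⁻¹ * ((1-s)^2) ^ z.1.natAbs := by
    funext z; rw [← pow_mul, mul_comm 2, pow_mul]; ring
  have v0 : 0 ≤ (1-s)^2 := sq_nonneg _
  have v1 : (1-s)^2 < 1 := by nlinarith
  rw [e, Hs_add t0 t1 ((gr_one.smul _).add ((gr_pow u0 u1.le).smul _)) ((gr_pow v0 v1.le).smul _),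
    Hs_add t0 t1 (gr_one.smul _) ((gr_pow u0 u1.le).smul _), Hs_smul, Hs_smul, Hs_smul, Hs_one h0 h1,
    Hs_pow h0 h1 u0 u1, Hs_pow h0 h1 v0 v1, sub_sub_cancel, show 1 - (1-s)^2 = 2 * s - s^2 by ring]
  simp only [Function.comp]
  have hs0 := hs.1.ne'
  have hs2 : 2 * s - s^2 ≠ 0 := by nlinarith [hs.1, hs.2]
  have hs3 : 2 - s ≠ 0 := by linarith [hs.2]
  rw [show 2 * s - s^2 = s * (2 - s) by ring] at *
  field_simp
  ring

theorem stepAvg_one : stepAvg (fun _ => (1:ℝ)) = fun _ => 1 := by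
  funext z; simp [stepAvg]; norm_num

theorem G_one {ε : ℝ} (h0 : 0 < ε) (h1 : ε < 1) : ε^2 * Gt (1 - ε^2) (fun _ => 1) = FF ε 0 := by
  obtain ⟨t0, t1⟩ := tt_mem h0 h1
  have := stop_id t0 t1 gr_one
  rw [Hs_one h0 h1, stepAvg_one] at this
  rw [← Gt_smul]
  convert this using 1
  · congr 1; funext z; ring
  · ring

/-- the constant `κ` -/
noncomputable def kp : ℝ := √(1 + √2) / 2

theorem mm_tendsto : Tendsto mm (𝓝[>] 0) (𝓝 (kp/2)) := by
  have hc : Continuous mm := by unfold mm dl; fun_prop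
  have := (hc.tendsto 0).mono_left (nhdsWithin_le_nhds (s := Ioi 0))
  convert this using 2
  simp [mm, dl, kp]; ring

theorem q_eq {ε : ℝ} : √(RR ε 0) = 2 * √ε := by
  rw [RR_zero, Real.sqrt_mul (by norm_num), show (4:ℝ) = 2^2 by norm_num, Real.sqrt_sq (by norm_num)]

theorem sqrt_lim : Tendsto (fun ε : ℝ => √ε) (𝓝[>] 0) (𝓝 0) := by
  have := (Real.continuous_sqrt.tendsto 0).mono_left (nhdsWithin_le_nhds (s := Ioi 0))
  rwa [Real.sqrt_zero] at this

theorem r1_lim : Tendsto r1 (𝓝[>] 0) (𝓝 2) := by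
  have hc : Continuous r1 := by unfold r1 dl; fun_prop
  have := (hc.tendsto 0).mono_left (nhdsWithin_le_nhds (s := Ioi 0))
  convert this using 2
  simp [r1]

theorem r2_lim : Tendsto r2 (𝓝[>] 0) (𝓝 (√2 - 1)) := by
  have hc : Continuous r2 := by unfold r2 dl; fun_prop
  have := (hc.tendsto 0).mono_left (nhdsWithin_le_nhds (s := Ioi 0))
  convert this using 2
  simp [r2, dl]

theorem lim_G : Tendsto (fun ε => √ε^3 * Gt (1 - ε^2) (fun _ => 1)) (𝓝[>] 0) (𝓝 kp) := by
  have := mm_tendsto.const_mul 2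
  rw [show 2 * (kp/2) = kp by ring] at this
  refine this.congr' ?_
  filter_upwards [Ioo_mem_nhdsGT zero_lt_one] with ε hε
  have h := G_one hε.1 hε.2
  have hs := Real.sqrt_pos.2 hε.1
  have h2 := Real.sq_sqrt hε.1.le
  unfold FF at h
  rw [q_eq] at h
  generalize √ε = y at *
  rw [← h2] at h ⊢
  have : y * (y^3 * Gt (1 - (y^2)^2) (fun _ => 1) - 2 * mm (y^2)) = 0 := by linear_combination h
  rcases mul_eq_zero.1 this with h3 | h3
  · exact absurd h3 hs.ne'
  · linarith

theorem lim_MA : Tendsto (fun ε => √ε * MA ε) (𝓝[>] 0) (𝓝 (kp/4)) := by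
  have := (mm_tendsto.mul r1_lim).div_const 4
  rw [show kp/2 * 2 / 4 = kp/4 by ring] at this
  refine this.congr' ?_
  filter_upwards [self_mem_nhdsWithin] with ε hε
  have hs := Real.sqrt_pos.2 (show (0:ℝ) < ε from hε)
  unfold MA
  rw [q_eq]
  field_simp
  ring

theorem lim_MB : Tendsto (fun ε => √ε^3 * MB ε) (𝓝[>] 0) (𝓝 (kp/16)) := by
  have := mm_tendsto.mul ((((sqrt_lim.pow 2).mul r1_lim).div_const 4).sub
    (((sqrt_lim.pow 2).mul r2_lim).div_const 2) |>.add ((r1_lim.pow 2).div_const 32))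
  rw [show kp/2 * ((0:ℝ)^2 * 2 / 4 - 0^2 * (√2 - 1)/2 + 2^2/32) = kp/16 by ring] at this
  refine this.congr' ?_
  filter_upwards [self_mem_nhdsWithin] with ε hε
  have hs := Real.sqrt_pos.2 (show (0:ℝ) < ε from hε)
  unfold MB MA
  rw [q_eq]
  field_simp
  ring

end Mom

end SlitAux

namespace SlitAux

/-! ### Part E: the radial moment -/

section Rad
open Set Topology Real

/-- smoothed absolute value -/
noncomputable def phi (v : ℝ) : ℝ := |v| + exp (-|v|)

theorem phi_neg (v : ℝ) : phi (-v) = phi v := by simp [phi]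

theorem exp3 {y : ℝ} (hy : |y| ≤ 1) : |exp y - (1 + y + y^2/2)| ≤ |y|^3 / 4 := by
  have := Real.exp_bound hy (n := 3) (by norm_num)
  have e : ∑ m ∈ Finset.range 3, y^m / (m.factorial : ℝ) = 1 + y + y^2/2 := by
    simp [Finset.sum_range_succ]
  rw [e] at this
  refine this.trans ?_
  have h3 : 0 ≤ |y|^3 := by positivity
  norm_num [Nat.factorial]
  linarith

theorem phi_taylor_aux {v k : ℝ} (hv : 0 ≤ v) (hk0 : 0 ≤ k) (hk : k ≤ 1/2) :
    |(phi (v+k) + phi (v-k))/2 - phi v - k^2/2 * exp (-|v|)| ≤ 4 * k^3 := by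
  unfold phi
  have hk3 : 0 ≤ k^3 := by positivity
  rw [abs_of_nonneg hv, abs_of_nonneg (by linarith : 0 ≤ v + k)]
  rcases le_total k v with h | h
  · rw [abs_of_nonneg (by linarith : 0 ≤ v - k)]
    have a1 : exp (-(v+k)) = exp (-v) * exp (-k) := by rw [← exp_add]; ring_nf
    have a2 : exp (-(v-k)) = exp (-v) * exp k := by rw [← exp_add]; ring_nf
    have b1 := exp3 (y := k) (by rw [abs_of_nonneg hk0]; linarith)
    have b2 := exp3 (y := -k) (by rw [abs_neg, abs_of_nonneg hk0]; linarith)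
    rw [abs_neg] at b2
    rw [abs_of_nonneg hk0] at b1 b2
    have e0 := exp_pos (-v)
    have e1 : exp (-v) ≤ 1 := by rw [exp_le_one_iff]; linarith
    rw [a1, a2]
    generalize exp (-v) = a at *
    generalize exp (-k) = p at *
    generalize exp k = q at *
    have : (v + k + a * p + (v - k + a * q))/2 - (v + a) - k^2/2 * a
        = a * ((p - (1 + -k + (-k)^2/2) + (q - (1 + k + k^2/2)))/2) := by ring
    rw [this, abs_mul, abs_of_pos e0]
    have h2 : |(p - (1 + -k + (-k)^2/2) + (q - (1 + k + k^2/2)))/2| ≤ k^3/4 := by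
      rw [abs_le] at *; constructor <;> linarith [b1.1, b1.2, b2.1, b2.2]
    calc a * |(p - (1 + -k + (-k)^2/2) + (q - (1 + k + k^2/2)))/2| ≤ 1 * (k^3/4) :=
          mul_le_mul e1 h2 (abs_nonneg _) zero_le_one
      _ ≤ _ := by linarith
  · rw [abs_of_nonpos (by linarith : v - k ≤ 0)]
    have b1 := exp3 (y := -(v+k)) (by rw [abs_neg, abs_of_nonneg (by linarith)]; linarith)
    have b2 := exp3 (y := -(-(v-k))) (by rw [neg_neg, abs_of_nonpos (by linarith)]; linarith)
    have b3 := exp3 (y := -v) (by rw [abs_neg, abs_of_nonneg hv]; linarith)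
    rw [abs_neg, abs_of_nonneg (by linarith : 0 ≤ v + k)] at b1
    rw [neg_neg, abs_of_nonpos (by linarith : v - k ≤ 0)] at b2
    rw [abs_neg, abs_of_nonneg hv] at b3
    have c1 : (v+k)^3 ≤ (2*k)^3 := pow_le_pow_left₀ (by linarith) (by linarith) 3
    have c2 : (-(v-k))^3 ≤ k^3 := pow_le_pow_left₀ (by linarith) (by linarith) 3
    have c3 : v^3 ≤ k^3 := pow_le_pow_left₀ hv h 3
    have d1 : exp (-v) ≤ 1 := by rw [exp_le_one_iff]; linarith
    have d2 : 1 - v ≤ exp (-v) := by linarith [add_one_le_exp (-v)]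
    have d3 : |k^2/2 * (exp (-v) - 1)| ≤ k^3/2 := by
      rw [abs_le]
      constructor <;> nlinarith [mul_nonneg (sq_nonneg k) (by linarith : 0 ≤ k - v), sq_nonneg k]
    rw [neg_neg]
    generalize exp (-v) = a at *
    generalize exp (-(v+k)) = p at *
    generalize exp (v-k) = q at *
    have : (v + k + p + (-(v - k) + q))/2 - (v + a) - k^2/2 * a
        = ((p - (1 + -(v+k) + (-(v+k))^2/2)) + (q - (1 + (v-k) + (v-k)^2/2)))/2
          - (a - (1 + -v + (-v)^2/2)) - k^2/2 * (a - 1) := by ring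
    rw [this]
    rw [abs_le] at *
    constructor <;> linarith [b1.1, b1.2, b2.1, b2.2, b3.1, b3.2, d3.1, d3.2]

theorem phi_taylor {v k : ℝ} (hk : |k| ≤ 1/2) :
    |(phi (v+k) + phi (v-k))/2 - phi v - k^2/2 * exp (-|v|)| ≤ 4 * |k|^3 := by
  have key : ∀ v : ℝ, 0 ≤ v → |(phi (v+k) + phi (v-k))/2 - phi v - k^2/2 * exp (-|v|)| ≤ 4 * |k|^3 := by
    intro v hv
    rcases le_total 0 k with h | h
    · rw [abs_of_nonneg h] at hk ⊢
      exact phi_taylor_aux hv h hk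
    · rw [abs_of_nonpos h] at hk
      have := phi_taylor_aux hv (by linarith : 0 ≤ -k) hk
      rw [← abs_of_nonpos h] at *
      rw [abs_of_nonpos h] at *
      rw [show v + -k = v - k by ring, show v - -k = v + k by ring, add_comm (phi (v-k)), neg_sq] at this
      exact this
  rcases le_total 0 v with h | h
  · exact key v h
  · have := key (-v) (by linarith)
    rw [phi_neg, abs_neg, ← phi_neg (-v + k), ← phi_neg (-v - k), show -(-v + k) = v - k by ring,
      show -(-v - k) = v + k by ring, add_comm (phi (v-k))] at this
    exact this

/-- rescaled version -/
noncomputable def psi (ε u : ℝ) : ℝ := phi (2 * ε * u) / (2 * ε)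

theorem psi_eq {ε : ℝ} (h0 : 0 < ε) (u : ℝ) : psi ε u = |u| + exp (-(2 * ε * |u|)) / (2 * ε) := by
  unfold psi phi
  rw [abs_mul, abs_of_pos (by positivity : 0 < 2 * ε)]
  field_simp

theorem psi_taylor {ε u h : ℝ} (h0 : 0 < ε) (h1 : ε ≤ 1/4) (hh : |h| ≤ 1) :
    |(psi ε (u+h) + psi ε (u-h))/2 - psi ε u - ε * h^2 * exp (-(2 * ε * |u|))| ≤ 16 * ε^2 := by
  have hb : |2 * ε * h| ≤ 2 * ε := by
    rw [abs_mul, abs_of_pos (by positivity : 0 < 2 * ε)]; nlinarith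
  have := phi_taylor (v := 2 * ε * u) (k := 2 * ε * h) (hb.trans (by linarith))
  rw [← mul_add, ← mul_sub, abs_mul (2 * ε) u, abs_of_pos (by positivity : 0 < 2 * ε)] at this
  unfold psi
  have e : (phi (2 * ε * (u+h)) / (2*ε) + phi (2 * ε * (u-h)) / (2*ε))/2 - phi (2 * ε * u) / (2*ε)
      - ε * h^2 * exp (-(2 * ε * |u|)) = ((phi (2 * ε * (u+h)) + phi (2 * ε * (u-h)))/2 - phi (2 * ε * u)
      - (2 * ε * h)^2/2 * exp (-(2 * ε * |u|))) / (2 * ε) := by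
    field_simp
  rw [e, abs_div, abs_of_pos (by positivity : 0 < 2 * ε), div_le_iff₀ (by positivity)]
  have h3 : |2 * ε * h|^3 ≤ (2 * ε)^3 := pow_le_pow_left₀ (abs_nonneg _) hb 3
  calc _ ≤ 4 * |2 * ε * h|^3 := this
    _ ≤ 4 * (2 * ε)^3 := by linarith
    _ = 16 * ε^2 * (2 * ε) := by ring

/-- linear form -/
noncomputable def UU (θ : ℝ) (z : ℤ × ℤ) : ℝ := z.1 * cos θ + z.2 * sin θ

theorem UU_le (θ : ℝ) (z : ℤ × ℤ) : |UU θ z| ≤ |(z.1:ℝ)| + |(z.2:ℝ)| := by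
  unfold UU
  refine (abs_add_le _ _).trans ?_
  rw [abs_mul, abs_mul]
  exact add_le_add (mul_le_of_le_one_right (abs_nonneg _) (abs_cos_le_one θ))
    (mul_le_of_le_one_right (abs_nonneg _) (abs_sin_le_one θ))

theorem gr_UU (θ : ℝ) : Gr (fun z => |UU θ z|) := by
  apply Gr.of_lin (C := 1)
  intro z
  rw [abs_abs]
  linarith [UU_le θ z]

theorem psi_lap {ε : ℝ} (h0 : 0 < ε) (h1 : ε ≤ 1/4) (θ : ℝ) (z : ℤ × ℤ) :
    |psi ε (UU θ z) - (1 - ε^2) * stepAvg (fun z => psi ε (UU θ z)) z - ε^2 * abs (UU θ z)| ≤ 17 * ε^2 := by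
  have a1 := psi_taylor (u := UU θ z) h0 h1 (abs_cos_le_one θ)
  have a2 := psi_taylor (u := UU θ z) h0 h1 (abs_sin_le_one θ)
  have s : stepAvg (fun z => psi ε (UU θ z)) z = ((psi ε (UU θ z + cos θ) + psi ε (UU θ z - cos θ))/2
      + (psi ε (UU θ z + sin θ) + psi ε (UU θ z - sin θ))/2)/2 := by
    unfold stepAvg UU
    push_cast
    ring_nf
  rw [s]
  have e0 := exp_pos (-(2 * ε * |UU θ z|))
  have e1 : exp (-(2 * ε * |UU θ z|)) ≤ 1 := by
    rw [exp_le_one_iff]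
    have := abs_nonneg (UU θ z)
    have : 0 ≤ 2 * ε * |UU θ z| := by positivity
    linarith
  have hp := psi_eq h0 (UU θ z)
  set E := exp (-(2 * ε * |UU θ z|)) with hE
  have hp2 : psi ε (UU θ z) * (2 * ε) = |UU θ z| * (2 * ε) + E := by rw [hp]; field_simp
  generalize psi ε (UU θ z) = P at *
  generalize (psi ε (UU θ z + cos θ) + psi ε (UU θ z - cos θ))/2 = A at *
  generalize (psi ε (UU θ z + sin θ) + psi ε (UU θ z - sin θ))/2 = B at *
  have hcs := cos_sq_add_sin_sq θ
  have id : P - (1 - ε^2) * ((A + B)/2) - ε^2 * |UU θ z|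
      = -(1 - ε^2) * (((A - P - ε * cos θ^2 * E) + (B - P - ε * sin θ^2 * E))/2) + ε^2 * (ε/2 * E) := by
    linear_combination (ε/2) * hp2 - (1 - ε^2) * (ε * E/2) * hcs
  rw [id]
  have t1 : |((A - P - ε * cos θ^2 * E) + (B - P - ε * sin θ^2 * E))/2| ≤ 16 * ε^2 := by
    rw [abs_le] at *; constructor <;> linarith [a1.1, a1.2, a2.1, a2.2]
  have t2 : |ε^2 * (ε/2 * E)| ≤ ε^2 := by
    rw [abs_of_pos (by positivity)]
    have : ε/2 * E ≤ 1 := by nlinarith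
    nlinarith [sq_nonneg ε]
  have t3 : |-(1 - ε^2)| ≤ 1 := by rw [abs_neg, abs_le]; constructor <;> nlinarith
  refine (abs_add_le _ _).trans ?_
  rw [abs_mul]
  have := mul_le_mul t3 t1 (abs_nonneg _) zero_le_one
  linarith

theorem Hs_pow' {ε x : ℝ} (h0 : 0 < ε) (h1 : ε < 1) (hx0 : 0 ≤ x) (hx1 : x ≤ 1) :
    Hs (1 - ε^2) (fun z => x ^ z.1.natAbs) = 1 - FF ε (1 - x) := by
  rcases hx1.lt_or_eq with h | h
  · exact Hs_pow h0 h1 hx0 h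
  · subst h
    simpa using Hs_one h0 h1

theorem gr_psi {ε : ℝ} (h0 : 0 < ε) (θ : ℝ) : Gr (fun z => psi ε (UU θ z)) := by
  have h2 : Gr (fun z => exp (-(2 * ε * |UU θ z|)) / (2 * ε)) := by
    apply Gr.of_bdd (C := 1 / (2 * ε))
    intro z
    rw [abs_of_pos (by positivity)]
    gcongr
    rw [exp_le_one_iff]
    have : 0 ≤ 2 * ε * |UU θ z| := by positivity
    linarith
  have := (gr_UU θ).add h2
  refine (congrArg Gr ?_).mp this
  funext z
  rw [psi_eq h0]

theorem G_psi {ε : ℝ} (h0 : 0 < ε) (h1 : ε < 1) {θ : ℝ} (hc : 0 ≤ cos θ) :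
    Gt (1 - ε^2) (fun z => psi ε (UU θ z) - (1 - ε^2) * stepAvg (fun z => psi ε (UU θ z)) z)
      = FF ε (1 - exp (-(2 * ε * cos θ))) / (2 * ε) - cos θ * MA ε := by
  obtain ⟨t0, t1⟩ := tt_mem h0 h1
  rw [stop_id t0 t1 (gr_psi h0 θ)]
  have x0 := (exp_pos (-(2 * ε * cos θ))).le
  have x1 : exp (-(2 * ε * cos θ)) ≤ 1 := by
    rw [exp_le_one_iff]
    have : 0 ≤ 2 * ε * cos θ := by positivity
    linarith
  have e : Hs (1 - ε^2) (fun z => psi ε (UU θ z)) = Hs (1 - ε^2) (fun z => cos θ * |(z.1:ℝ)|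
      + (2 * ε)⁻¹ * exp (-(2 * ε * cos θ)) ^ z.1.natAbs) := by
    apply Hs_congr
    rintro ⟨k, l⟩ ⟨hl, hk⟩
    simp only at hl
    subst hl
    rw [psi_eq h0]
    have : |UU θ (k, 0)| = cos θ * |(k:ℝ)| := by
      simp [UU, abs_mul, abs_of_nonneg hc, mul_comm]
    rw [this, ← exp_nat_mul, natAbs_cast, div_eq_inv_mul]
    congr 3
    ring
  have gk : Gr (fun z : ℤ × ℤ => |(z.1:ℝ)|) := Gr.of_lin (C := 1) fun z => by
    rw [abs_abs]; linarith [abs_nonneg (z.2:ℝ)]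
  rw [e, Hs_add t0 t1 (gk.smul _) ((gr_pow x0 x1).smul _), Hs_smul, Hs_smul, Hs_abs h0 h1,
    Hs_pow' h0 h1 x0 x1, psi_eq h0]
  simp [UU]
  field_simp
  ring

theorem G_UU {ε : ℝ} (h0 : 0 < ε) (h1 : ε ≤ 1/4) {θ : ℝ} (hc : 0 ≤ cos θ) :
    |ε^2 * Gt (1 - ε^2) (fun z => |UU θ z|)
      - (FF ε (1 - exp (-(2 * ε * cos θ))) / (2 * ε) - cos θ * MA ε)| ≤ 17 * FF ε 0 := by
  have h1' : ε < 1 := by linarith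
  obtain ⟨t0, t1⟩ := tt_mem h0 h1'
  rw [← G_psi h0 h1' hc, ← Gt_smul]
  have g1 := gr_psi h0 θ
  rw [abs_sub_comm, ← Gt_sub t0 t1 (g1.sub (g1.stepAvg.smul _)) ((gr_UU θ).smul _)]
  refine (Gt_abs_le t0 t1 (psi_lap h0 h1 θ)).trans (le_of_eq ?_)
  rw [← G_one h0 h1']; ring

end Rad

end SlitAux

namespace SlitAux

section Rad2
open Set Topology Real MeasureTheory

/-- Euclidean norm -/
noncomputable def rad (z : ℤ × ℤ) : ℝ := √((z.1:ℝ)^2 + (z.2:ℝ)^2)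

theorem UU_cont (z : ℤ × ℤ) : Continuous (fun θ => |UU θ z|) := by
  unfold UU; fun_prop

theorem rad_int (z : ℤ × ℤ) : ∫ θ in (-(π/2))..(π/2), |UU θ z| = 2 * rad z := by
  set w : ℂ := ⟨z.1, z.2⟩ with hw
  have hr : ‖w‖ = rad z := by
    rw [Complex.norm_def, Complex.normSq_mk, rad]; congr 1; ring
  have h1 := Complex.norm_mul_cos_arg w
  have h2 := Complex.norm_mul_sin_arg w
  have e : ∀ θ, |UU θ z| = rad z * |cos (θ - w.arg)| := by
    intro θ
    have : UU θ z = rad z * cos (θ - w.arg) := by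
      unfold UU
      have a : (z.1:ℝ) = w.re := rfl
      have b : (z.2:ℝ) = w.im := rfl
      rw [a, b, ← h1, ← h2, hr, cos_sub]; ring
    rw [this, abs_mul, abs_of_nonneg (show 0 ≤ rad z from Real.sqrt_nonneg _)]
  simp_rw [e]
  rw [intervalIntegral.integral_const_mul, intervalIntegral.integral_comp_sub_right (fun x => |cos x|)]
  have hp : Function.Periodic (fun x => |cos x|) π := by
    intro x; simp only [cos_add_pi, abs_neg]
  have := hp.intervalIntegral_add_eq (-(π/2) - w.arg) (-(π/2))
  rw [show -(π/2) - w.arg + π = π/2 - w.arg by ring, show -(π/2) + π = π/2 by ring] at this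
  rw [this]
  have : ∫ x in (-(π/2))..(π/2), |cos x| = ∫ x in (-(π/2))..(π/2), cos x := by
    apply intervalIntegral.integral_congr
    intro x hx
    rw [uIcc_of_le (by linarith [pi_pos])] at hx
    exact abs_of_nonneg (cos_nonneg_of_mem_Icc hx)
  rw [this, integral_cos]
  simp
  ring

theorem gr_rad : Gr rad := by
  apply Gr.of_lin (C := 1)
  intro z
  unfold rad
  rw [abs_of_nonneg (sqrt_nonneg _)]
  apply Real.sqrt_le_iff.mpr
  have a := abs_nonneg (z.1:ℝ)
  have b := abs_nonneg (z.2:ℝ)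
  constructor
  · positivity
  · rw [← sq_abs (z.1:ℝ), ← sq_abs (z.2:ℝ)]; nlinarith

theorem En_cont (n : ℕ) : Continuous (fun θ => En n (fun z => |UU θ z|)) := by
  unfold En
  exact (continuous_finsetSum _ fun w _ => UU_cont _).div_const _

theorem En_int (n : ℕ) : ∫ θ in (-(π/2))..(π/2), En n (fun z => |UU θ z|) = 2 * En n rad := by
  unfold En
  rw [intervalIntegral.integral_div, intervalIntegral.integral_finsetSum
    (fun w _ => (UU_cont _).intervalIntegrable _ _)]
  simp_rw [rad_int]
  rw [← Finset.mul_sum]; ring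

theorem En_UU_bound (n : ℕ) (θ : ℝ) : |En n (fun z => |UU θ z|)| ≤ (1 + 2 * (n:ℝ))^2 := by
  have := En_growth n (f := fun z => |UU θ z|) (C := 1) zero_le_one (fun z => by
    rw [abs_abs, one_mul]
    have a := abs_nonneg (z.1:ℝ)
    have b := abs_nonneg (z.2:ℝ)
    refine (UU_le θ z).trans ?_
    unfold wt
    nlinarith)
  rwa [one_mul] at this

theorem Gt_UU_cont {t : ℝ} (h0 : 0 ≤ t) (h1 : t < 1) : Continuous (fun θ => Gt t (fun z => |UU θ z|)) := by
  unfold Gt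
  refine continuous_tsum (fun n => (En_cont n).const_mul _) (summable_quad h0 h1) fun n θ => ?_
  rw [norm_mul, norm_pow, Real.norm_eq_abs, Real.norm_eq_abs, abs_of_nonneg h0]
  exact mul_le_mul_of_nonneg_left (En_UU_bound n θ) (by positivity)

theorem Gt_rad {t : ℝ} (h0 : 0 ≤ t) (h1 : t < 1) :
    ∫ θ in (-(π/2))..(π/2), Gt t (fun z => |UU θ z|) = 2 * Gt t rad := by
  have := intervalIntegral.hasSum_integral_of_dominated_convergence (μ := volume)
    (a := -(π/2)) (b := π/2)
    (F := fun (n:ℕ) θ => t^n * En n (fun z => |UU θ z|)) (f := fun θ => Gt t (fun z => |UU θ z|))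
    (fun n _ => t^n * (1 + 2 * (n:ℝ))^2)
    (fun n => ((En_cont n).const_mul _).aestronglyMeasurable)
    (fun n => Eventually.of_forall fun θ _ => by
      rw [norm_mul, norm_pow, Real.norm_eq_abs, Real.norm_eq_abs, abs_of_nonneg h0]
      exact mul_le_mul_of_nonneg_left (En_UU_bound n θ) (by positivity))
    (Eventually.of_forall fun θ _ => summable_quad h0 h1)
    (intervalIntegrable_const)
    (Eventually.of_forall fun θ _ => (summable_G h0 h1 (gr_UU θ)).hasSum)
  rw [← this.tsum_eq]
  unfold Gt
  rw [← tsum_mul_left]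
  congr 1; funext n
  rw [intervalIntegral.integral_const_mul, En_int]; ring

/-- rescaled main term -/
theorem FF_scaled {ε : ℝ} (h0 : 0 < ε) (s : ℝ) :
    √ε * (FF ε s / (2 * ε)) = mm ε * √((1 + (1 - ε) * (s / (2 * ε))) * (1 + (dl ε - 1) * s / 2)) := by
  have e : RR ε s = (2 * √ε)^2 * ((1 + (1 - ε) * (s / (2 * ε))) * (1 + (dl ε - 1) * s / 2)) := by
    rw [mul_pow, sq_sqrt h0.le]; unfold RR; field_simp
  unfold FF
  rw [e, sqrt_mul (sq_nonneg _), sqrt_sq (by positivity)]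
  have hs := sq_sqrt h0.le
  have : √ε ≠ 0 := (sqrt_pos.mpr h0).ne'
  generalize √((1 + (1 - ε) * (s / (2 * ε))) * (1 + (dl ε - 1) * s / 2)) = X
  field_simp
  rw [hs]; ring

theorem s_lim (c : ℝ) : Tendsto (fun ε : ℝ => (1 - exp (-(2 * ε * c))) / (2 * ε)) (𝓝[>] 0) (𝓝 c) := by
  have h : HasDerivAt (fun ε : ℝ => -exp (-(2 * ε * c)) / 2) c 0 := by
    have h1 : HasDerivAt (fun ε : ℝ => -(2 * ε * c)) (-(2 * 1 * c)) 0 :=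
      (((hasDerivAt_id (0:ℝ)).const_mul 2).mul_const c).neg
    have := h1.exp.neg.div_const 2
    have e : -(exp (-(2 * 0 * c)) * (-(2 * 1 * c))) / 2 = c := by simp
    rw [e] at this
    exact this
  have := h.tendsto_slope_zero_right
  refine this.congr fun ε => ?_
  simp
  field_simp
  ring

theorem s_bound {ε c : ℝ} (h0 : 0 < ε) (hc : 0 ≤ c) :
    0 ≤ 1 - exp (-(2 * ε * c)) ∧ 1 - exp (-(2 * ε * c)) ≤ 2 * ε * c := by
  have : 0 ≤ 2 * ε * c := by positivity
  constructor
  · have : exp (-(2 * ε * c)) ≤ 1 := by rw [exp_le_one_iff]; linarith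
    linarith
  · linarith [add_one_le_exp (-(2 * ε * c))]

theorem dl_le {ε : ℝ} : dl ε ≤ 2 := by
  unfold dl
  rw [sqrt_le_left (by norm_num)]
  nlinarith

theorem dl_lim : Tendsto dl (𝓝[>] 0) (𝓝 (√2)) := by
  have hc : Continuous dl := by unfold dl; fun_prop
  have := (hc.tendsto 0).mono_left (nhdsWithin_le_nhds (s := Ioi 0))
  convert this using 2
  simp [dl]

theorem id_lim : Tendsto (fun ε : ℝ => ε) (𝓝[>] 0) (𝓝 0) :=
  tendsto_id.mono_left nhdsWithin_le_nhds

theorem main_lim (c : ℝ) : Tendsto (fun ε : ℝ => √ε * (FF ε (1 - exp (-(2 * ε * c))) / (2 * ε)))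
    (𝓝[>] 0) (𝓝 (kp / 2 * √(1 + c))) := by
  have hs0 : Tendsto (fun ε : ℝ => 1 - exp (-(2 * ε * c))) (𝓝[>] 0) (𝓝 0) := by
    have hc : Continuous (fun ε : ℝ => 1 - exp (-(2 * ε * c))) := by fun_prop
    have := (hc.tendsto 0).mono_left (nhdsWithin_le_nhds (s := Ioi 0))
    convert this using 2
    simp
  have l1 := ((id_lim.const_sub 1).mul (s_lim c)).const_add 1
  have l2 := (((dl_lim.sub_const 1).mul hs0).div_const 2).const_add 1
  have l3 := mm_tendsto.mul ((continuous_sqrt.tendsto _).comp (l1.mul l2))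
  rw [show (1 + (1 - 0) * c) * (1 + (√2 - 1) * 0 / 2) = 1 + c by ring] at l3
  refine l3.congr' ?_
  filter_upwards [self_mem_nhdsWithin] with ε hε
  rw [FF_scaled hε]
  rfl

theorem main_bound {ε c : ℝ} (h0 : 0 < ε) (h1 : ε ≤ 1/4) (hc : 0 ≤ c) (hc1 : c ≤ 1) :
    |√ε * (FF ε (1 - exp (-(2 * ε * c))) / (2 * ε))| ≤ 2 * mm ε := by
  obtain ⟨s0, s1⟩ := s_bound h0 hc
  rw [FF_scaled h0]
  have hd := dl_gt h0 (by linarith)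
  have hd2 := dl_le (ε := ε)
  have hm : 0 ≤ mm ε := by unfold mm; positivity
  rw [abs_of_nonneg (by positivity)]
  generalize 1 - exp (-(2 * ε * c)) = s at *
  have a1 : s / (2 * ε) ≤ 1 := by rw [div_le_one (by positivity)]; nlinarith
  have a0 : 0 ≤ s / (2 * ε) := by positivity
  have : √((1 + (1 - ε) * (s / (2 * ε))) * (1 + (dl ε - 1) * s / 2)) ≤ 2 := by
    rw [sqrt_le_left (by norm_num)]
    have b1 : 1 + (1 - ε) * (s / (2 * ε)) ≤ 2 := by nlinarith
    have b2 : 1 + (dl ε - 1) * s / 2 ≤ 2 := by nlinarith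
    have b3 : 0 ≤ 1 + (dl ε - 1) * s / 2 := by nlinarith
    nlinarith
  nlinarith

theorem err_lim : Tendsto (fun ε => √ε * (17 * FF ε 0)) (𝓝[>] 0) (𝓝 0) := by
  have := ((sqrt_lim.pow 2).mul mm_tendsto).const_mul 34
  rw [show (34:ℝ) * (0^2 * (kp/2)) = 0 by ring] at this
  refine this.congr fun ε => ?_
  unfold FF
  rw [q_eq]; ring

theorem sqrt5 {ε : ℝ} (h0 : 0 < ε) : √ε^5 = √ε * ε^2 := by
  nth_rewrite 3 [← sq_sqrt h0.le]; ring

theorem UU_scaled {ε : ℝ} (h0 : 0 < ε) (h1 : ε ≤ 1/4) {θ : ℝ} (hc : 0 ≤ cos θ) :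
    |√ε^5 * Gt (1 - ε^2) (fun z => |UU θ z|)
      - (√ε * (FF ε (1 - exp (-(2 * ε * cos θ))) / (2 * ε)) - cos θ * (√ε * MA ε))| ≤ √ε * (17 * FF ε 0) := by
  have := G_UU h0 h1 hc
  rw [sqrt5 h0]
  have e : √ε * ε^2 * Gt (1 - ε^2) (fun z => |UU θ z|)
      - (√ε * (FF ε (1 - exp (-(2 * ε * cos θ))) / (2 * ε)) - cos θ * (√ε * MA ε))
      = √ε * (ε^2 * Gt (1 - ε^2) (fun z => |UU θ z|)
      - (FF ε (1 - exp (-(2 * ε * cos θ))) / (2 * ε) - cos θ * MA ε)) := by ring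
  rw [e, abs_mul, abs_of_nonneg (sqrt_nonneg ε)]
  exact mul_le_mul_of_nonneg_left this (sqrt_nonneg ε)

theorem small_ev : ∀ᶠ ε : ℝ in 𝓝[>] 0, 0 < ε ∧ ε ≤ 1/4 := by
  filter_upwards [Ioo_mem_nhdsGT (show (0:ℝ) < 1/4 by norm_num)] with ε hε
  exact ⟨hε.1, hε.2.le⟩

theorem UU_lim {θ : ℝ} (hc : 0 ≤ cos θ) :
    Tendsto (fun ε => √ε^5 * Gt (1 - ε^2) (fun z => |UU θ z|)) (𝓝[>] 0)
      (𝓝 (kp / 2 * √(1 + cos θ) - cos θ * (kp/4))) := by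
  have l := (main_lim (cos θ)).sub (lim_MA.const_mul (cos θ))
  have d : Tendsto (fun ε => √ε^5 * Gt (1 - ε^2) (fun z => |UU θ z|)
      - (√ε * (FF ε (1 - exp (-(2 * ε * cos θ))) / (2 * ε)) - cos θ * (√ε * MA ε))) (𝓝[>] 0) (𝓝 0) := by
    refine squeeze_zero_norm' ?_ err_lim
    filter_upwards [small_ev] with ε hε
    exact UU_scaled hε.1 hε.2 hc
  have := d.add l
  simpa using this

theorem lim_int : ∫ θ in (-(π/2))..(π/2), (kp / 2 * √(1 + cos θ) - cos θ * (kp/4)) = 3/2 * kp := by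
  have e : ∫ θ in (-(π/2))..(π/2), (kp / 2 * √(1 + cos θ) - cos θ * (kp/4))
      = ∫ θ in (-(π/2))..(π/2), (kp / 2 * √2 * cos (θ/2) - kp/4 * cos θ) := by
    apply intervalIntegral.integral_congr
    intro θ hθ
    rw [uIcc_of_le (by linarith [pi_pos])] at hθ
    have : √(1 + cos θ) = √2 * cos (θ/2) := by
      have h := cos_sq (θ/2)
      rw [show 2 * (θ/2) = θ by ring] at h
      have hc : 0 ≤ cos (θ/2) := cos_nonneg_of_mem_Icc ⟨by linarith [hθ.1, pi_pos], by linarith [hθ.2, pi_pos]⟩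
      rw [show 1 + cos θ = 2 * cos (θ/2)^2 by rw [h]; ring, sqrt_mul (by norm_num), sqrt_sq hc]
    simp only [this]; ring
  rw [e, intervalIntegral.integral_sub (by apply Continuous.intervalIntegrable; fun_prop)
    (by apply Continuous.intervalIntegrable; fun_prop), intervalIntegral.integral_const_mul,
    intervalIntegral.integral_const_mul, intervalIntegral.integral_comp_div (f := cos) (by norm_num),
    integral_cos, integral_cos]
  rw [show -(π/2)/2 = -(π/4) by ring, show π/2/2 = π/4 by ring, sin_neg, sin_neg, sin_pi_div_four, sin_pi_div_two]
  have := sq_sqrt (show (0:ℝ) ≤ 2 by norm_num)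
  simp only [smul_eq_mul]
  linear_combination kp * this

theorem lim_rad : Tendsto (fun ε => √ε^5 * Gt (1 - ε^2) rad) (𝓝[>] 0) (𝓝 (3/4 * kp)) := by
  have key : Tendsto (fun ε => ∫ θ in (-(π/2))..(π/2), √ε^5 * Gt (1 - ε^2) (fun z => |UU θ z|)) (𝓝[>] 0)
      (𝓝 (∫ θ in (-(π/2))..(π/2), (kp / 2 * √(1 + cos θ) - cos θ * (kp/4)))) := by
    have hcos : ∀ θ ∈ Set.uIoc (-(π/2)) (π/2), 0 ≤ cos θ := by
      intro θ hθ
      rw [uIoc_of_le (by linarith [pi_pos])] at hθ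
      exact cos_nonneg_of_mem_Icc ⟨hθ.1.le, hθ.2⟩
    refine intervalIntegral.tendsto_integral_filter_of_dominated_convergence
      (fun _ => 2 * (kp/2 + 1) + (kp/4 + 1) + 1) ?_ ?_ intervalIntegrable_const ?_
    · filter_upwards [small_ev] with ε hε
      obtain ⟨t0, t1⟩ := tt_mem hε.1 (by linarith [hε.2])
      exact ((Gt_UU_cont t0 t1).const_mul _).aestronglyMeasurable
    · have e1 := mm_tendsto.eventually (gt_mem_nhds (lt_add_one (kp/2)))
      have e2 := lim_MA.eventually (Ioo_mem_nhds (sub_one_lt (kp/4)) (lt_add_one (kp/4)))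
      have e3 := err_lim.eventually (gt_mem_nhds zero_lt_one)
      filter_upwards [small_ev, e1, e2, e3] with ε hε h1 h2 h3
      refine Eventually.of_forall fun θ hθ => ?_
      have hc := hcos θ hθ
      have a := UU_scaled hε.1 hε.2 hc
      have b := main_bound hε.1 hε.2 hc (cos_le_one θ)
      have hd := dl_gt hε.1 (by linarith [hε.2])
      have hMA : 0 ≤ √ε * MA ε := by
        have : 0 ≤ mm ε := by unfold mm; positivity
        have : 0 ≤ r1 ε := by unfold r1; nlinarith [hε.1, hε.2]
        unfold MA; positivity
      have m1 : cos θ * (√ε * MA ε) ≤ 1 * (√ε * MA ε) := mul_le_mul_of_nonneg_right (cos_le_one θ) hMA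
      have m0 : 0 ≤ cos θ * (√ε * MA ε) := mul_nonneg hc hMA
      rw [Real.norm_eq_abs]
      rw [abs_le] at *
      have h22 := h2.2
      constructor <;> linarith [a.1, a.2, b.1, b.2]
    · exact Eventually.of_forall fun θ hθ => UU_lim (hcos θ hθ)
  rw [lim_int] at key
  have := key.div_const 2
  rw [show 3/2 * kp / 2 = 3/4 * kp by ring] at this
  refine this.congr' ?_
  filter_upwards [small_ev] with ε hε
  obtain ⟨t0, t1⟩ := tt_mem hε.1 (by linarith [hε.2])
  rw [intervalIntegral.integral_const_mul, Gt_rad t0 t1]; ring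

/-- drift of the radius -/
noncomputable def dr (z : ℤ × ℤ) : ℝ := stepAvg rad z - rad z

theorem gr_dr : Gr dr := gr_rad.stepAvg.sub gr_rad

theorem dr_nonneg (z : ℤ × ℤ) : 0 ≤ dr z := by
  have key : ∀ a b c d e f : ℝ, a + c = 2 * e → b + d = 2 * f →
      2 * √(e^2 + f^2) ≤ √(a^2 + b^2) + √(c^2 + d^2) := by
    intro a b c d e f h1 h2
    have n := norm_add_le (⟨a, b⟩ : ℂ) ⟨c, d⟩
    have hh : ∀ p q : ℝ, ‖(⟨p, q⟩ : ℂ)‖ = √(p^2 + q^2) := by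
      intro p q; rw [Complex.norm_def, Complex.normSq_mk]; congr 1; ring
    have s : (⟨a, b⟩ : ℂ) + ⟨c, d⟩ = ⟨2 * e, 2 * f⟩ := by
      apply Complex.ext <;> simp [h1, h2]
    rw [s, hh, hh, hh, show (2 * e)^2 + (2 * f)^2 = 2^2 * (e^2 + f^2) by ring, sqrt_mul (by norm_num),
      sqrt_sq (by norm_num)] at n
    exact n
  have k1 := key (z.1 + 1) z.2 (z.1 - 1) z.2 z.1 z.2 (by ring) (by ring)
  have k2 := key z.1 (z.2 + 1) z.1 (z.2 - 1) z.1 z.2 (by ring) (by ring)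
  unfold dr stepAvg rad
  push_cast
  linarith

theorem lim_dr : Tendsto (fun ε => √ε * Gt (1 - ε^2) dr) (𝓝[>] 0) (𝓝 kp) := by
  have l := (lim_rad.add lim_MA).div ((id_lim.pow 2).const_sub 1) (by norm_num)
  rw [show (3/4 * kp + kp/4) / (1 - 0^2) = kp by ring] at l
  refine l.congr' ?_
  filter_upwards [small_ev] with ε hε
  have h1 : ε < 1 := by linarith [hε.2]
  obtain ⟨t0, t1⟩ := tt_mem hε.1 h1
  have st := stop_id t0 t1 gr_rad
  have hH : Hs (1 - ε^2) rad = MA ε := by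
    rw [← Hs_abs hε.1 h1]
    apply Hs_congr
    rintro ⟨k, l⟩ ⟨hl, hk⟩
    simp only at hl
    subst hl
    simp [rad, sqrt_sq_eq_abs]
  have r0 : rad (0,0) = 0 := by simp [rad]
  rw [hH, r0, Gt_sub t0 t1 gr_rad (gr_rad.stepAvg.smul _), Gt_smul] at st
  have hd : Gt (1 - ε^2) dr = Gt (1 - ε^2) (stepAvg rad) - Gt (1 - ε^2) rad :=
    Gt_sub t0 t1 gr_rad.stepAvg gr_rad
  have hne : (1 - ε^2) ≠ 0 := by nlinarith [hε.1]
  simp only [Pi.div_apply]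
  rw [hd, sqrt5 hε.1, div_eq_iff hne]
  linear_combination √ε * st

end Rad2

end SlitAux

namespace SlitAux

/-! ### Part F: the Karamata Tauberian theorem -/

section Karamata
open Set MeasureTheory Topology

theorem kar_summable {a : ℕ → ℝ} (ha : ∀ n, 0 ≤ a n)
    (hs : ∀ t ∈ Ioo (0:ℝ) 1, Summable (fun n => a n * t^n)) {g : ℝ → ℝ} {M : ℝ}
    (hg : ∀ x ∈ Icc (0:ℝ) 1, |g x| ≤ M) {t : ℝ} (ht : t ∈ Ioo (0:ℝ) 1) :
    Summable (fun n => a n * t^n * g (t^n)) := by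
  refine Summable.of_norm_bounded ((hs t ht).mul_right M) fun n => ?_
  have h1 : t^n ∈ Icc (0:ℝ) 1 := ⟨pow_nonneg ht.1.le _, pow_le_one₀ ht.1.le ht.2.le⟩
  have h2 : 0 ≤ a n * t^n := mul_nonneg (ha n) h1.1
  rw [Real.norm_eq_abs, abs_mul, abs_of_nonneg h2]
  exact mul_le_mul_of_nonneg_left (hg _ h1) h2

theorem kar_exp_mem {y : ℝ} (hy : y ∈ Ioi (0:ℝ)) : Real.exp (-y) ∈ Icc (0:ℝ) 1 :=
  ⟨(Real.exp_pos _).le, Real.exp_le_one_iff.2 (by simpa using le_of_lt hy)⟩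

theorem kar_integrable {γ : ℝ} (hγ : 0 < γ) {g : ℝ → ℝ} {M : ℝ} (hgm : Measurable g)
    (hg : ∀ x ∈ Icc (0:ℝ) 1, |g x| ≤ M) :
    IntegrableOn (fun y => Real.exp (-y) * y^(γ-1) * g (Real.exp (-y))) (Ioi 0) := by
  have h1 := Real.GammaIntegral_convergent hγ
  refine Integrable.mono' (g := fun y => Real.exp (-y) * y^(γ-1) * M) (h1.mul_const M) ?_ ?_
  · apply Measurable.aestronglyMeasurable
    fun_prop
  · refine (ae_restrict_iff' measurableSet_Ioi).2 (Eventually.of_forall fun y hy => ?_)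
    have h2 : 0 ≤ Real.exp (-y) * y^(γ-1) :=
      mul_nonneg (Real.exp_pos _).le (Real.rpow_nonneg (le_of_lt hy) _)
    rw [Real.norm_eq_abs, abs_mul, abs_of_nonneg h2]
    exact mul_le_mul_of_nonneg_left (hg _ (kar_exp_mem hy)) h2

/-- the weighted Abel sums -/
noncomputable def karA (a : ℕ → ℝ) (γ : ℝ) (g : ℝ → ℝ) (t : ℝ) : ℝ :=
  (1-t)^γ * ∑' n, a n * t^n * g (t^n)

/-- the limit functional -/
noncomputable def karJ (γ : ℝ) (g : ℝ → ℝ) : ℝ :=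
  ∫ y in Ioi (0:ℝ), Real.exp (-y) * y^(γ-1) * g (Real.exp (-y))

theorem kar_monomial {a : ℕ → ℝ} {γ L : ℝ} (hγ : 0 < γ)
    (hlim : Tendsto (fun t => (1-t)^γ * ∑' n, a n * t^n) (𝓝[<] 1) (𝓝 L)) (m : ℕ) :
    Tendsto (karA a γ (fun x => x^m)) (𝓝[<] 1) (𝓝 (L / Real.Gamma γ * karJ γ (fun x => x^m))) := by
  have hJ : L / Real.Gamma γ * karJ γ (fun x => x^m) = (1/((m:ℝ)+1))^γ * L := by
    have h1 : karJ γ (fun x => x^m) = (1/((m:ℝ)+1))^γ * Real.Gamma γ := by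
      rw [← Real.integral_rpow_mul_exp_neg_mul_Ioi hγ (by positivity), karJ]
      congr 1
      funext y
      rw [← Real.exp_nat_mul, mul_right_comm, ← Real.exp_add]
      rw [mul_comm]
      congr 2
      ring
    rw [h1]
    have := (Real.Gamma_pos_of_pos hγ).ne'
    field_simp
  rw [hJ]
  have hmap : Tendsto (fun t : ℝ => t^(m+1)) (𝓝[<] 1) (𝓝[<] 1) := by
    apply tendsto_nhdsWithin_of_tendsto_nhds_of_eventually_within
    · have : Tendsto (fun t : ℝ => t^(m+1)) (𝓝 1) (𝓝 (1^(m+1))) := (continuous_pow _).tendsto _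
      rw [one_pow] at this
      exact this.mono_left nhdsWithin_le_nhds
    · have : Ioo (0:ℝ) 1 ∈ 𝓝[<] (1:ℝ) := Ioo_mem_nhdsLT zero_lt_one
      filter_upwards [this] with t ht
      exact pow_lt_one₀ ht.1.le ht.2 (by omega)
  have h2 := hlim.comp hmap
  have h3 : Tendsto (fun t : ℝ => (1 / ∑ i ∈ Finset.range (m+1), t^i)^γ) (𝓝[<] 1)
      (𝓝 ((1/((m:ℝ)+1))^γ)) := by
    have hc : Tendsto (fun t : ℝ => ∑ i ∈ Finset.range (m+1), t^i) (𝓝[<] 1) (𝓝 ((m:ℝ)+1)) := by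
      have : Tendsto (fun t : ℝ => ∑ i ∈ Finset.range (m+1), t^i) (𝓝 1)
        (𝓝 (∑ i ∈ Finset.range (m+1), (1:ℝ)^i)) :=
        (continuous_finsetSum _ (fun i _ => continuous_pow i)).tendsto 1
      simp only [one_pow, Finset.sum_const, Finset.card_range, nsmul_eq_mul, mul_one] at this
      push_cast at this
      exact this.mono_left nhdsWithin_le_nhds
    have h4 : Tendsto (fun t : ℝ => (1 / ∑ i ∈ Finset.range (m+1), t^i)) (𝓝[<] 1)
      (𝓝 (1/((m:ℝ)+1))) := tendsto_const_nhds.div hc (by positivity)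
    exact h4.rpow_const (Or.inr hγ.le)
  refine (h3.mul h2).congr' ?_
  have : Ioo (0:ℝ) 1 ∈ 𝓝[<] (1:ℝ) := Ioo_mem_nhdsLT zero_lt_one
  filter_upwards [this] with t ht
  simp only [Function.comp, karA]
  have h5 : (1 - t) * ∑ i ∈ Finset.range (m+1), t^i = 1 - t^(m+1) := mul_neg_geom_sum t (m+1)
  have h6 : 0 < ∑ i ∈ Finset.range (m+1), t^i :=
    Finset.sum_pos (fun i _ => pow_pos ht.1 i) (by simp)
  have h7 : 0 < 1 - t := by linarith [ht.2]
  rw [← h5, ← mul_assoc, ← Real.mul_rpow (by positivity) (by positivity)]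
  congr 1
  · congr 1
    field_simp
  · congr 1
    funext n
    rw [mul_assoc, ← pow_succ', ← pow_mul, ← pow_mul, mul_comm]
    ring_nf

theorem kar_poly {a : ℕ → ℝ} (ha : ∀ n, 0 ≤ a n) {γ L : ℝ} (hγ : 0 < γ)
    (hs : ∀ t ∈ Ioo (0:ℝ) 1, Summable (fun n => a n * t^n))
    (hlim : Tendsto (fun t => (1-t)^γ * ∑' n, a n * t^n) (𝓝[<] 1) (𝓝 L)) (p : Polynomial ℝ) :
    Tendsto (karA a γ (fun x => p.eval x)) (𝓝[<] 1)
      (𝓝 (L / Real.Gamma γ * karJ γ (fun x => p.eval x))) := by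
  have hb : ∀ p : Polynomial ℝ, ∃ M, ∀ x ∈ Icc (0:ℝ) 1, |p.eval x| ≤ M := by
    intro p
    obtain ⟨M, hM⟩ := isCompact_Icc.exists_bound_of_continuousOn (s := Icc (0:ℝ) 1)
      (f := fun x => p.eval x) p.continuous.continuousOn
    exact ⟨M, hM⟩
  induction p using Polynomial.induction_on' with
  | add p q hp hq =>
    obtain ⟨M, hM⟩ := hb p
    obtain ⟨N, hN⟩ := hb q
    have e : karJ γ (fun x => (p+q).eval x) = karJ γ (fun x => p.eval x) + karJ γ (fun x => q.eval x) := by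
      unfold karJ
      rw [← integral_add (kar_integrable hγ p.continuous.measurable hM)
        (kar_integrable hγ q.continuous.measurable hN)]
      congr 1
      funext y
      simp only [Polynomial.eval_add]; ring
    rw [e, mul_add]
    refine (hp.add hq).congr' ?_
    have : Ioo (0:ℝ) 1 ∈ 𝓝[<] (1:ℝ) := Ioo_mem_nhdsLT zero_lt_one
    filter_upwards [this] with t ht
    unfold karA
    rw [← mul_add, ← Summable.tsum_add (kar_summable ha hs hM ht) (kar_summable ha hs hN ht)]
    congr 2
    funext n
    simp only [Polynomial.eval_add]; ring
  | monomial m c =>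
    have h := (kar_monomial hγ hlim m).const_mul c
    have e : karJ γ (fun x => ((Polynomial.monomial m) c).eval x) = c * karJ γ (fun x => x^m) := by
      unfold karJ
      rw [← integral_const_mul]
      congr 1
      funext y
      simp only [Polynomial.eval_monomial]; ring
    rw [e, mul_left_comm]
    refine h.congr fun t => ?_
    unfold karA
    rw [mul_left_comm, ← tsum_mul_left]
    congr 2
    funext n
    simp only [Polynomial.eval_monomial]; ring

theorem karA_mono {a : ℕ → ℝ} (ha : ∀ n, 0 ≤ a n) {γ : ℝ}
    (hs : ∀ t ∈ Ioo (0:ℝ) 1, Summable (fun n => a n * t^n)) {g h : ℝ → ℝ} {M N : ℝ}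
    (hg : ∀ x ∈ Icc (0:ℝ) 1, |g x| ≤ M) (hh : ∀ x ∈ Icc (0:ℝ) 1, |h x| ≤ N)
    (hgh : ∀ x ∈ Icc (0:ℝ) 1, g x ≤ h x) {t : ℝ} (ht : t ∈ Ioo (0:ℝ) 1) :
    karA a γ g t ≤ karA a γ h t := by
  unfold karA
  apply mul_le_mul_of_nonneg_left _ (Real.rpow_nonneg (by linarith [ht.2]) _)
  apply Summable.tsum_le_tsum _ (kar_summable ha hs hg ht) (kar_summable ha hs hh ht)
  intro n
  have h1 : t^n ∈ Icc (0:ℝ) 1 := ⟨pow_nonneg ht.1.le _, pow_le_one₀ ht.1.le ht.2.le⟩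
  exact mul_le_mul_of_nonneg_left (hgh _ h1) (mul_nonneg (ha n) h1.1)

theorem karJ_mono {γ : ℝ} (hγ : 0 < γ) {g h : ℝ → ℝ} {M N : ℝ} (hgm : Measurable g)
    (hhm : Measurable h)
    (hg : ∀ x ∈ Icc (0:ℝ) 1, |g x| ≤ M) (hh : ∀ x ∈ Icc (0:ℝ) 1, |h x| ≤ N)
    (hgh : ∀ x ∈ Icc (0:ℝ) 1, g x ≤ h x) : karJ γ g ≤ karJ γ h := by
  unfold karJ
  apply setIntegral_mono_on (kar_integrable hγ hgm hg) (kar_integrable hγ hhm hh) measurableSet_Ioi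
  intro y hy
  exact mul_le_mul_of_nonneg_left (hgh _ (kar_exp_mem hy))
    (mul_nonneg (Real.exp_pos _).le (Real.rpow_nonneg (le_of_lt hy) _))

theorem kar_const {γ : ℝ} (hγ : 0 < γ) (c : ℝ) : karJ γ (fun _ => c) = c * Real.Gamma γ := by
  rw [Real.Gamma_eq_integral hγ, karJ, ← integral_const_mul]
  congr 1
  funext y
  ring

/-- limits for a bounded function sandwiched between polynomials -/
theorem kar_sandwich {a : ℕ → ℝ} (ha : ∀ n, 0 ≤ a n) {γ L : ℝ} (hγ : 0 < γ)
    (hs : ∀ t ∈ Ioo (0:ℝ) 1, Summable (fun n => a n * t^n))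
    (hlim : Tendsto (fun t => (1-t)^γ * ∑' n, a n * t^n) (𝓝[<] 1) (𝓝 L)) (hL : 0 ≤ L)
    {h : ℝ → ℝ} {N c : ℝ} (hh : ∀ x ∈ Icc (0:ℝ) 1, |h x| ≤ N)
    (hsand : ∀ η > 0, ∃ g₁ g₂ : ℝ → ℝ, Continuous g₁ ∧ Continuous g₂ ∧
      (∀ x ∈ Icc (0:ℝ) 1, g₁ x ≤ h x) ∧ (∀ x ∈ Icc (0:ℝ) 1, h x ≤ g₂ x) ∧
      c - η ≤ karJ γ g₁ ∧ karJ γ g₂ ≤ c + η) :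
    Tendsto (karA a γ h) (𝓝[<] 1) (𝓝 (L / Real.Gamma γ * c)) := by
  have hG := Real.Gamma_pos_of_pos hγ
  have hb : ∀ p : Polynomial ℝ, ∃ M, ∀ x ∈ Icc (0:ℝ) 1, |p.eval x| ≤ M := by
    intro p
    obtain ⟨M, hM⟩ := isCompact_Icc.exists_bound_of_continuousOn (s := Icc (0:ℝ) 1)
      (f := fun x => p.eval x) p.continuous.continuousOn
    exact ⟨M, hM⟩
  have key : ∀ g : ℝ → ℝ, Continuous g → ∀ η > 0, ∃ p : Polynomial ℝ,
      (∀ x ∈ Icc (0:ℝ) 1, g x ≤ p.eval x) ∧ karJ γ (fun x => p.eval x) ≤ karJ γ g + η := by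
    intro g hg η hη
    obtain ⟨p, hp⟩ := exists_polynomial_near_of_continuousOn 0 1 g hg.continuousOn
      (η / (2 * Real.Gamma γ)) (by positivity)
    obtain ⟨Mg, hMg⟩ := isCompact_Icc.exists_bound_of_continuousOn (s := Icc (0:ℝ) 1) hg.continuousOn
    refine ⟨p + Polynomial.C (η / (2 * Real.Gamma γ)), fun x hx => ?_, ?_⟩
    · have := abs_lt.1 (hp x hx)
      simp only [Polynomial.eval_add, Polynomial.eval_C]
      linarith [this.1]
    · obtain ⟨M, hM⟩ := hb (p + Polynomial.C (η / (2 * Real.Gamma γ)))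
      have hbd : ∀ x ∈ Icc (0:ℝ) 1, |g x + η / Real.Gamma γ| ≤ Mg + η / Real.Gamma γ := by
        intro x hx
        refine (abs_add_le _ _).trans ?_
        have h3 := hMg x hx
        rw [Real.norm_eq_abs] at h3
        rw [abs_of_pos (by positivity : 0 < η / Real.Gamma γ)]
        linarith
      have := karJ_mono hγ (g := fun x => (p + Polynomial.C (η / (2 * Real.Gamma γ))).eval x)
        (h := fun x => g x + η / Real.Gamma γ) (Polynomial.continuous _).measurable
        (hg.measurable.add_const _) hM hbd (by
          intro x hx
          have := abs_lt.1 (hp x hx)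
          simp only [Polynomial.eval_add, Polynomial.eval_C]
          have e : η / Real.Gamma γ = η / (2 * Real.Gamma γ) + η / (2 * Real.Gamma γ) := by
            field_simp; ring
          linarith [this.2])
      refine this.trans (le_of_eq ?_)
      have e : karJ γ (fun x => g x + η / Real.Gamma γ) = karJ γ g + karJ γ (fun _ => η / Real.Gamma γ) := by
        unfold karJ
        rw [← integral_add (kar_integrable hγ hg.measurable hMg)
          (kar_integrable (M := |η / Real.Gamma γ|) hγ measurable_const (fun _ _ => le_rfl))]
        congr 1
        funext y
        ring
      rw [e, kar_const hγ]
      field_simp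
  have hI : Ioo (0:ℝ) 1 ∈ 𝓝[<] (1:ℝ) := Ioo_mem_nhdsLT zero_lt_one
  have hLG : 0 ≤ L / Real.Gamma γ := by positivity
  rw [tendsto_order]
  constructor
  · intro b hb'
    obtain ⟨η, hη, hη2⟩ : ∃ η > 0, L / Real.Gamma γ * (2 * η) < L / Real.Gamma γ * c - b := by
      refine ⟨(L / Real.Gamma γ * c - b) / (4 * (L / Real.Gamma γ + 1)), ?_, ?_⟩
      · have : 0 < L / Real.Gamma γ * c - b := by linarith
        positivity
      · have : 0 < L / Real.Gamma γ * c - b := by linarith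
        set D := L / Real.Gamma γ * c - b
        set k := L / Real.Gamma γ
        rw [show k * (2 * (D / (4 * (k + 1)))) = D * (k / (2 * (k+1))) by field_simp; ring]
        have : k / (2 * (k+1)) < 1 := by rw [div_lt_one (by positivity)]; linarith
        nlinarith
    obtain ⟨g₁, g₂, hg1, hg2, h1, h2, h3, h4⟩ := hsand η hη
    obtain ⟨p, hp1, hp2⟩ := key (fun x => - g₁ x) hg1.neg η hη
    obtain ⟨M, hM⟩ := hb (-p)
    have hlim2 := kar_poly ha hγ hs hlim (-p)
    have e1 : karJ γ (fun x => (-p).eval x) = - karJ γ (fun x => p.eval x) := by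
      unfold karJ; rw [← integral_neg]; congr 1; funext y; simp only [Polynomial.eval_neg]; ring
    have e2 : karJ γ (fun x => - g₁ x) = - karJ γ g₁ := by
      unfold karJ; rw [← integral_neg]; congr 1; funext y; ring
    have h5 : b < L / Real.Gamma γ * karJ γ (fun x => (-p).eval x) := by
      have : c - 2 * η ≤ karJ γ (fun x => (-p).eval x) := by rw [e1]; rw [e2] at hp2; linarith
      have := mul_le_mul_of_nonneg_left this hLG
      linarith
    filter_upwards [hI, (tendsto_order.1 hlim2).1 b h5] with t ht htb
    refine htb.trans_le (karA_mono ha hs hM hh ?_ ht)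
    intro x hx
    rw [Polynomial.eval_neg]
    linarith [hp1 x hx, h1 x hx]
  · intro b hb'
    obtain ⟨η, hη, hη2⟩ : ∃ η > 0, L / Real.Gamma γ * (2 * η) < b - L / Real.Gamma γ * c := by
      refine ⟨(b - L / Real.Gamma γ * c) / (4 * (L / Real.Gamma γ + 1)), ?_, ?_⟩
      · have : 0 < b - L / Real.Gamma γ * c := by linarith
        positivity
      · have : 0 < b - L / Real.Gamma γ * c := by linarith
        set D := b - L / Real.Gamma γ * c
        set k := L / Real.Gamma γ
        rw [show k * (2 * (D / (4 * (k + 1)))) = D * (k / (2 * (k+1))) by field_simp; ring]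
        have : k / (2 * (k+1)) < 1 := by rw [div_lt_one (by positivity)]; linarith
        nlinarith
    obtain ⟨g₁, g₂, hg1, hg2, h1, h2, h3, h4⟩ := hsand η hη
    obtain ⟨p, hp1, hp2⟩ := key g₂ hg2 η hη
    obtain ⟨M, hM⟩ := hb p
    have hlim2 := kar_poly ha hγ hs hlim p
    have h5 : L / Real.Gamma γ * karJ γ (fun x => p.eval x) < b := by
      have : karJ γ (fun x => p.eval x) ≤ c + 2 * η := by linarith
      have := mul_le_mul_of_nonneg_left this hLG
      linarith
    filter_upwards [hI, (tendsto_order.1 hlim2).2 b h5] with t ht htb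
    refine (karA_mono ha hs hh hM ?_ ht).trans_lt htb
    intro x hx
    linarith [hp1 x hx, h2 x hx]

/-- the cut-off function -/
noncomputable def karh (x : ℝ) : ℝ := if Real.exp (-1) < x then x⁻¹ else 0

theorem kar_ramp (f : ℕ → ℝ → ℝ) (hf : ∀ m x, f m x = (max x (Real.exp (-1)))⁻¹ *
      min 1 (max 0 ((m:ℝ) * (x - Real.exp (-1))))
     ∨ f m x = (max x (Real.exp (-1)))⁻¹ *
      min 1 (max 0 (1 + (m:ℝ) * (x - Real.exp (-1))))) (m : ℕ) (x : ℝ) :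
    |f m x| ≤ Real.exp 1 := by
  have h0 := Real.exp_pos (-1)
  have h1 : 0 < max x (Real.exp (-1)) := lt_max_of_lt_right h0
  have h2 : (max x (Real.exp (-1)))⁻¹ ≤ Real.exp 1 := by
    rw [show Real.exp 1 = (Real.exp (-1))⁻¹ by rw [Real.exp_neg, inv_inv]]
    exact inv_anti₀ h0 (le_max_right _ _)
  have h3 : ∀ v : ℝ, |min 1 (max 0 v)| ≤ 1 := by
    intro v
    rw [abs_of_nonneg (le_min zero_le_one (le_max_left _ _))]
    exact min_le_left _ _
  rcases hf m x with h | h <;> rw [h, abs_mul, abs_of_pos (inv_pos.2 h1)]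
  · calc _ ≤ Real.exp 1 * 1 := mul_le_mul h2 (h3 _) (abs_nonneg _) (Real.exp_pos _).le
      _ = _ := mul_one _
  · calc _ ≤ Real.exp 1 * 1 := mul_le_mul h2 (h3 _) (abs_nonneg _) (Real.exp_pos _).le
      _ = _ := mul_one _

theorem kar_dom {γ : ℝ} (hγ : 0 < γ) (f : ℕ → ℝ → ℝ) (hc : ∀ m, Continuous (f m)) {M : ℝ}
    (hM : ∀ m x, |f m x| ≤ M)
    (hl : ∀ x, x ≠ Real.exp (-1) → Tendsto (fun m => f m x) atTop (𝓝 (karh x))) :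
    Tendsto (fun m => karJ γ (f m)) atTop (𝓝 (karJ γ karh)) := by
  unfold karJ
  apply tendsto_integral_of_dominated_convergence (fun y => Real.exp (-y) * y^(γ-1) * M)
  · intro m
    apply Measurable.aestronglyMeasurable
    have := (hc m).measurable
    fun_prop
  · exact (Real.GammaIntegral_convergent hγ).mul_const M
  · intro m
    refine (ae_restrict_iff' measurableSet_Ioi).2 (Eventually.of_forall fun y hy => ?_)
    have h2 : 0 ≤ Real.exp (-y) * y^(γ-1) :=
      mul_nonneg (Real.exp_pos _).le (Real.rpow_nonneg (le_of_lt hy) _)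
    rw [Real.norm_eq_abs, abs_mul, abs_of_nonneg h2]
    exact mul_le_mul_of_nonneg_left (hM _ _) h2
  · apply ae_restrict_of_ae
    have : ∀ᵐ y : ℝ, y ≠ 1 := by
      simp [ae_iff]
    filter_upwards [this] with y hy
    apply Tendsto.const_mul
    apply hl
    intro h
    apply hy
    have := Real.exp_injective h
    linarith

theorem karJ_karh {γ : ℝ} (hγ : 0 < γ) : karJ γ karh = 1 / γ := by
  have h1 : karJ γ karh = ∫ y in Ioi (0:ℝ), (Ioo (0:ℝ) 1).indicator (fun y => y^(γ-1)) y := by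
    unfold karJ
    apply setIntegral_congr_fun measurableSet_Ioi
    intro y hy
    by_cases h : y < 1
    · have : y ∈ Ioo (0:ℝ) 1 := ⟨hy, h⟩
      simp only [indicator_of_mem this, karh]
      rw [if_pos (by rw [Real.exp_lt_exp]; linarith)]
      have := (Real.exp_pos (-y)).ne'
      field_simp
    · have : y ∉ Ioo (0:ℝ) 1 := fun h' => h h'.2
      simp only [indicator_of_notMem this, karh]
      rw [if_neg (by rw [Real.exp_lt_exp]; linarith), mul_zero]
  have hsub : Ioo (0:ℝ) 1 ⊆ Ioi 0 := fun y hy => hy.1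
  rw [h1, setIntegral_indicator measurableSet_Ioo,
    inter_eq_right.2 hsub, ← integral_Ioc_eq_integral_Ioo,
    ← intervalIntegral.integral_of_le zero_le_one, integral_rpow (Or.inl (by linarith))]
  simp [hγ.ne']

theorem karamata {a : ℕ → ℝ} (ha : ∀ n, 0 ≤ a n) {γ L : ℝ} (hγ : 0 < γ) (hL : 0 ≤ L)
    (hs : ∀ t ∈ Ioo (0:ℝ) 1, Summable (fun n => a n * t^n))
    (hlim : Tendsto (fun t => (1-t)^γ * ∑' n, a n * t^n) (𝓝[<] 1) (𝓝 L)) :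
    Tendsto (fun n : ℕ => (∑ k ∈ Finset.range n, a k) / (n:ℝ)^γ) atTop
      (𝓝 (L / Real.Gamma (γ+1))) := by
  have h0 := Real.exp_pos (-1)
  have hcont : Continuous (fun x : ℝ => (max x (Real.exp (-1)))⁻¹) := by
    apply Continuous.inv₀ (by fun_prop)
    intro x
    exact (lt_max_of_lt_right h0).ne'
  have hh : ∀ x ∈ Icc (0:ℝ) 1, |karh x| ≤ Real.exp 1 := by
    intro x hx
    unfold karh
    split_ifs with h
    · rw [abs_of_pos (inv_pos.2 (h0.trans h)),
        show Real.exp 1 = (Real.exp (-1))⁻¹ by rw [Real.exp_neg, inv_inv]]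
      exact inv_anti₀ h0 h.le
    · rw [abs_zero]; exact (Real.exp_pos _).le
  have key : Tendsto (karA a γ karh) (𝓝[<] 1) (𝓝 (L / Real.Gamma γ * (1/γ))) := by
    apply kar_sandwich ha hγ hs hlim hL hh
    intro η hη
    set f₁ : ℕ → ℝ → ℝ := fun m x => (max x (Real.exp (-1)))⁻¹ *
      min 1 (max 0 ((m:ℝ) * (x - Real.exp (-1)))) with hf₁
    set f₂ : ℕ → ℝ → ℝ := fun m x => (max x (Real.exp (-1)))⁻¹ *
      min 1 (max 0 (1 + (m:ℝ) * (x - Real.exp (-1)))) with hf₂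
    have c1 : ∀ m, Continuous (f₁ m) := fun m => hcont.mul (by fun_prop)
    have c2 : ∀ m, Continuous (f₂ m) := fun m => hcont.mul (by fun_prop)
    have t1 : Tendsto (fun m => karJ γ (f₁ m)) atTop (𝓝 (karJ γ karh)) := by
      apply kar_dom hγ f₁ c1 (kar_ramp f₁ (fun m x => Or.inl rfl))
      intro x hx
      rcases lt_or_gt_of_ne hx with h | h
      · apply tendsto_const_nhds.congr
        intro m
        simp only [hf₁, karh, if_neg h.not_gt]
        rw [max_eq_left (mul_nonpos_of_nonneg_of_nonpos (Nat.cast_nonneg m) (by linarith))]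
        simp
      · apply tendsto_const_nhds.congr'
        have : Tendsto (fun m : ℕ => (m:ℝ) * (x - Real.exp (-1))) atTop atTop :=
          tendsto_natCast_atTop_atTop.atTop_mul_const (by linarith)
        filter_upwards [this.eventually_ge_atTop 1] with m hm
        simp only [hf₁, karh, if_pos h]
        rw [max_eq_right (by linarith : (0:ℝ) ≤ (m:ℝ) * (x - Real.exp (-1))), min_eq_left hm,
          max_eq_left h.le, mul_one]
    have t2 : Tendsto (fun m => karJ γ (f₂ m)) atTop (𝓝 (karJ γ karh)) := by
      apply kar_dom hγ f₂ c2 (kar_ramp f₂ (fun m x => Or.inr rfl))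
      intro x hx
      rcases lt_or_gt_of_ne hx with h | h
      · apply tendsto_const_nhds.congr'
        have : Tendsto (fun m : ℕ => (m:ℝ) * (Real.exp (-1) - x)) atTop atTop :=
          tendsto_natCast_atTop_atTop.atTop_mul_const (by linarith)
        filter_upwards [this.eventually_ge_atTop 1] with m hm
        simp only [hf₂, karh, if_neg h.not_gt]
        have hle : 1 + (m:ℝ) * (x - Real.exp (-1)) ≤ 0 := by linarith
        rw [max_eq_left hle]
        simp
      · apply tendsto_const_nhds.congr
        intro m
        simp only [hf₂, karh, if_pos h]
        have : 0 ≤ (m:ℝ) * (x - Real.exp (-1)) := mul_nonneg (Nat.cast_nonneg m) (by linarith)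
        rw [max_eq_right (by linarith : (0:ℝ) ≤ 1 + (m:ℝ) * (x - Real.exp (-1))),
          min_eq_left (by linarith), max_eq_left h.le, mul_one]
    rw [karJ_karh hγ] at t1 t2
    obtain ⟨m, hm1, hm2⟩ := (((tendsto_order.1 t1).1 (1/γ - η) (by linarith)).and
      ((tendsto_order.1 t2).2 (1/γ + η) (by linarith))).exists
    refine ⟨f₁ m, f₂ m, c1 m, c2 m, fun x _ => ?_, fun x _ => ?_, hm1.le, hm2.le⟩
    · simp only [hf₁, karh]
      split_ifs with h
      · rw [max_eq_left h.le]
        exact mul_le_of_le_one_right (inv_nonneg.2 (h0.trans h).le) (min_le_left _ _)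
      · rw [max_eq_left (mul_nonpos_of_nonneg_of_nonpos (Nat.cast_nonneg m) (by linarith))]
        simp
    · simp only [hf₂, karh]
      split_ifs with h
      · have : 0 ≤ (m:ℝ) * (x - Real.exp (-1)) := mul_nonneg (Nat.cast_nonneg m) (by linarith)
        rw [max_eq_right (by linarith : (0:ℝ) ≤ 1 + (m:ℝ) * (x - Real.exp (-1))),
          min_eq_left (by linarith), max_eq_left h.le, mul_one]
      · exact mul_nonneg (inv_nonneg.2 (lt_max_of_lt_right h0).le)
          (le_min zero_le_one (le_max_left _ _))
  have hinv : Tendsto (fun n : ℕ => -(1 / (n:ℝ))) atTop (𝓝 0) := by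
    simpa using (tendsto_one_div_atTop_nhds_zero_nat (𝕜 := ℝ)).neg
  have ht : Tendsto (fun n : ℕ => Real.exp (-(1 / (n:ℝ)))) atTop (𝓝[<] 1) := by
    apply tendsto_nhdsWithin_of_tendsto_nhds_of_eventually_within
    · have := (Real.continuous_exp.tendsto 0).comp hinv
      rwa [Real.exp_zero] at this
    · filter_upwards [eventually_gt_atTop 0] with n hn
      have : 0 < (n:ℝ) := Nat.cast_pos.2 hn
      exact Real.exp_lt_one_iff.2 (by simpa using this)
  have h1 := key.comp ht
  -- the factor `(n (1 - exp(-1/n)))^γ → 1`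
  have h2 : Tendsto (fun n : ℕ => ((n:ℝ) * (1 - Real.exp (-(1 / (n:ℝ)))))) atTop (𝓝 1) := by
    have hd : HasDerivAt (fun x : ℝ => Real.exp x) 1 0 := by
      simpa using Real.hasDerivAt_exp 0
    have := hd.tendsto_slope_zero
    have h3 : Tendsto (fun n : ℕ => -(1 / (n:ℝ))) atTop (𝓝[≠] 0) := by
      apply tendsto_nhdsWithin_of_tendsto_nhds_of_eventually_within _ hinv
      filter_upwards [eventually_gt_atTop 0] with n hn
      have : 0 < (n:ℝ) := Nat.cast_pos.2 hn
      simpa using this.ne'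
    refine (this.comp h3).congr' ?_
    filter_upwards [eventually_gt_atTop 0] with n hn
    have : 0 < (n:ℝ) := Nat.cast_pos.2 hn
    simp only [Function.comp, zero_add, Real.exp_zero, smul_eq_mul]
    field_simp
    ring
  have h3 : Tendsto (fun n : ℕ => (((n:ℝ) * (1 - Real.exp (-(1 / (n:ℝ)))))^γ)⁻¹) atTop (𝓝 1) := by
    have := (h2.rpow_const (p := γ) (Or.inl one_ne_zero)).inv₀ (by simp)
    simpa using this
  have h4 := h1.mul h3
  have e : L / Real.Gamma γ * (1/γ) * 1 = L / Real.Gamma (γ+1) := by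
    rw [Real.Gamma_add_one hγ.ne']
    have := (Real.Gamma_pos_of_pos hγ).ne'
    field_simp
  rw [e] at h4
  refine h4.congr' ?_
  filter_upwards [eventually_gt_atTop 0] with n hn
  have hn' : 0 < (n:ℝ) := Nat.cast_pos.2 hn
  simp only [Function.comp, karA]
  have hlt : 0 < 1 - Real.exp (-(1 / (n:ℝ))) := by
    have : Real.exp (-(1 / (n:ℝ))) < 1 := Real.exp_lt_one_iff.2 (by simpa using hn')
    linarith
  have hsum : ∑' k, a k * Real.exp (-(1 / (n:ℝ)))^k * karh (Real.exp (-(1 / (n:ℝ)))^k)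
      = ∑ k ∈ Finset.range n, a k := by
    have hk : ∀ k : ℕ, Real.exp (-1) < Real.exp (-(1 / (n:ℝ)))^k ↔ k < n := by
      intro k
      rw [← Real.exp_nat_mul, Real.exp_lt_exp]
      rw [show (k:ℝ) * -(1 / (n:ℝ)) = -((k:ℝ)/n) by ring, neg_lt_neg_iff, div_lt_one hn']
      exact Nat.cast_lt
    rw [tsum_eq_sum (s := Finset.range n)]
    · apply Finset.sum_congr rfl
      intro k hk'
      rw [karh, if_pos ((hk k).2 (Finset.mem_range.1 hk'))]
      have : Real.exp (-(1 / (n:ℝ)))^k ≠ 0 := pow_ne_zero _ (Real.exp_pos _).ne'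
      field_simp
    · intro k hk'
      rw [karh, if_neg, mul_zero]
      rw [hk]
      simpa using hk'
  rw [hsum, Real.mul_rpow hn'.le hlt.le]
  have : (1 - Real.exp (-(1 / (n:ℝ))))^γ ≠ 0 := (Real.rpow_pos_of_pos hlt _).ne'
  have : (n:ℝ)^γ ≠ 0 := (Real.rpow_pos_of_pos hn' _).ne'
  field_simp

end Karamata
end SlitAux

namespace SlitAux

section Final
open Set Topology

/-! ### Part G: conclusion -/

theorem kp_pos : 0 < kp := by unfold kp; positivity

theorem lim_conv {G : ℝ → ℝ} {L : ℝ} (k : ℕ)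
    (h : Tendsto (fun ε => √ε^k * G (1 - ε^2)) (𝓝[>] 0) (𝓝 L)) :
    Tendsto (fun t => (1 - t)^((k:ℝ)/4) * G t) (𝓝[<] 1) (𝓝 L) := by
  have hs : Tendsto (fun t : ℝ => √(1 - t)) (𝓝[<] 1) (𝓝[>] 0) := by
    apply tendsto_nhdsWithin_of_tendsto_nhds_of_eventually_within
    · have hc : Continuous (fun t : ℝ => √(1 - t)) := by fun_prop
      have := (hc.tendsto 1).mono_left (nhdsWithin_le_nhds (s := Iio 1))
      simpa using this
    · filter_upwards [self_mem_nhdsWithin] with t ht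
      exact Real.sqrt_pos.mpr (sub_pos.mpr ht)
  refine (h.comp hs).congr' ?_
  filter_upwards [self_mem_nhdsWithin] with t ht
  have h0 : 0 ≤ 1 - t := (sub_pos.mpr ht).le
  simp only [Function.comp]
  rw [Real.sq_sqrt h0, sub_sub_cancel, Real.sqrt_eq_rpow, Real.sqrt_eq_rpow, ← Real.rpow_mul h0,
    ← Real.rpow_mul_natCast h0]
  congr 2
  ring

theorem kar_G {f : ℤ × ℤ → ℝ} (hf : Gr f) (hp : ∀ z, 0 ≤ f z) {L : ℝ} (hL : 0 ≤ L) (k : ℕ) (hk : 0 < k)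
    (h : Tendsto (fun ε => √ε^k * Gt (1 - ε^2) f) (𝓝[>] 0) (𝓝 L)) :
    Tendsto (fun n : ℕ => (∑ j ∈ Finset.range n, En j f) / (n:ℝ)^((k:ℝ)/4)) atTop
      (𝓝 (L / Real.Gamma ((k:ℝ)/4 + 1))) := by
  refine karamata (fun n => En_nonneg n hp) (by positivity) hL ?_ ?_
  · intro t ht
    simpa only [mul_comm] using summable_G ht.1.le ht.2 hf
  · have := lim_conv (G := fun t => Gt t f) k h
    simpa only [Gt, mul_comm (_ ^ _ : ℝ) (En _ _)] using this

theorem kar_H {f : ℤ × ℤ → ℝ} (hf : Gr f) (hp : ∀ z ∈ slitH, 0 ≤ f z) {L : ℝ} (hL : 0 ≤ L) (k : ℕ) (hk : 0 < k)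
    (h : Tendsto (fun ε => √ε^k * Hs (1 - ε^2) f) (𝓝[>] 0) (𝓝 L)) :
    Tendsto (fun n : ℕ => (∑ j ∈ Finset.range n, hn j f) / (n:ℝ)^((k:ℝ)/4)) atTop
      (𝓝 (L / Real.Gamma ((k:ℝ)/4 + 1))) := by
  refine karamata (fun n => hn_nonneg n hp) (by positivity) hL ?_ ?_
  · intro t ht
    have := (summable_H ht.1.le ht.2 hf).mul_left t⁻¹
    refine this.congr fun n => ?_
    rw [pow_succ]
    field_simp [ht.1.ne']
  · have h1 := lim_conv (G := fun t => Hs t f) k h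
    have h2 : Tendsto (fun t : ℝ => t) (𝓝[<] 1) (𝓝 1) := tendsto_id.mono_left nhdsWithin_le_nhds
    have h3 := h1.div h2 one_ne_zero
    rw [div_one] at h3
    refine h3.congr' ?_
    filter_upwards [Ioo_mem_nhdsLT (show (0:ℝ) < 1 by norm_num)] with t ht
    have : Hs t f = t * ∑' n, hn n f * t^n := by
      unfold Hs
      rw [← tsum_mul_left]
      congr 1; funext n; ring
    simp only [Pi.div_apply]
    rw [this]
    have := ht.1.ne'
    field_simp

/-- monotone density -/
theorem mono_density {b : ℕ → ℝ} (hb : Antitone b) {γ A : ℝ} (hγ : 0 < γ)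
    (h : Tendsto (fun n : ℕ => (∑ j ∈ Finset.range n, b j) / (n:ℝ)^γ) atTop (𝓝 A)) :
    Tendsto (fun n : ℕ => b n * n / (n:ℝ)^γ) atTop (𝓝 (A * γ)) := by
  set S : ℕ → ℝ := fun n => ∑ j ∈ Finset.range n, b j with hS
  have up : ∀ n m : ℕ, S (n + m) - S n ≤ m * b n := by
    intro n m
    induction m with
    | zero => simp
    | succ m ih =>
      have : S (n + (m+1)) = S (n + m) + b (n + m) := Finset.sum_range_succ _ _
      rw [this]
      have := hb (Nat.le_add_right n m)
      push_cast
      linarith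
  have dn : ∀ m n : ℕ, m * b (n + m) ≤ S (n + m) - S n := by
    intro m n
    induction m with
    | zero => simp
    | succ m ih =>
      have : S (n + (m+1)) = S (n + m) + b (n + m) := Finset.sum_range_succ _ _
      rw [this]
      have := hb (show n + m ≤ n + (m+1) by omega)
      have h2 : (m:ℝ) * b (n + (m+1)) ≤ m * b (n + m) := mul_le_mul_of_nonneg_left this (by positivity)
      push_cast
      linarith
  -- sandwich: for every c
  have Fl : ∀ c : ℝ, 0 < c → Tendsto (fun n : ℕ => (⌊c * n⌋₊ : ℝ) / n) atTop (𝓝 c) := by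
    intro c hc
    exact (tendsto_nat_floor_mul_div_atTop hc.le).comp tendsto_natCast_atTop_atTop
  have Ft : ∀ c : ℝ, 0 < c → Tendsto (fun n : ℕ => ⌊c * n⌋₊) atTop atTop := by
    intro c hc
    exact tendsto_nat_floor_atTop.comp (tendsto_natCast_atTop_atTop.const_mul_atTop hc)
  have Sc : ∀ c : ℝ, 0 < c → Tendsto (fun n : ℕ => S ⌊c * n⌋₊ / (n:ℝ)^γ) atTop (𝓝 (A * c^γ)) := by
    intro c hc
    have := (h.comp (Ft c hc)).mul ((Fl c hc).rpow_const (p := γ) (Or.inl hc.ne'))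
    refine this.congr' ?_
    filter_upwards [(Ft c hc).eventually_gt_atTop 0, eventually_gt_atTop 0] with n hn1 hn2
    simp only [Function.comp]
    rw [Real.div_rpow (by positivity) (by positivity)]
    have : (0:ℝ) < (⌊c * n⌋₊ : ℝ) := by exact_mod_cast hn1
    have : (⌊c * n⌋₊ : ℝ)^γ ≠ 0 := by positivity
    field_simp
    rfl
  have Q : ∀ c : ℝ, 0 < c → c ≠ 1 → Tendsto (fun n : ℕ => (S ⌊c * n⌋₊ / (n:ℝ)^γ - S n / (n:ℝ)^γ)
      / ((⌊c * n⌋₊ : ℝ) / n - 1)) atTop (𝓝 ((A * c^γ - A) / (c - 1))) := by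
    intro c hc h1
    exact ((Sc c hc).sub h).div ((Fl c hc).sub_const 1) (sub_ne_zero.mpr h1)
  have sl : Tendsto (fun c : ℝ => (A * c^γ - A) / (c - 1)) (𝓝[≠] 1) (𝓝 (A * γ)) := by
    have hd : HasDerivAt (fun c : ℝ => A * c^γ) (A * γ) 1 := by
      have := (Real.hasDerivAt_rpow_const (x := 1) (p := γ) (Or.inl one_ne_zero)).const_mul A
      simpa using this
    have := hd.tendsto_slope
    refine this.congr fun c => ?_
    rw [slope_def_field]; simp
  rw [tendsto_order]
  constructor
  · intro a ha
    have e1 := (sl.mono_left (nhdsWithin_mono 1 (fun x (hx : x ∈ Ioi (1:ℝ)) => ne_of_gt hx))).eventually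
      (lt_mem_nhds ha)
    obtain ⟨c, hc1, hc⟩ := (e1.and self_mem_nhdsWithin).exists
    have hc : 1 < c := hc
    filter_upwards [(Q c (by linarith) hc.ne').eventually (lt_mem_nhds hc1), eventually_gt_atTop 0,
      (Fl c (by linarith)).eventually (lt_mem_nhds hc)] with n hn hn0 hf
    refine hn.trans_le ?_
    have hn0' : (0:ℝ) < n := by exact_mod_cast hn0
    have hle : n ≤ ⌊c * n⌋₊ := by
      have : (n:ℝ) < (⌊c * n⌋₊ : ℝ) := by rwa [lt_div_iff₀ hn0', one_mul] at hf
      exact_mod_cast this.le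
    obtain ⟨m, hm⟩ := Nat.exists_eq_add_of_le hle
    have := up n m
    rw [div_le_iff₀ (by linarith), hm]
    push_cast
    have hp : (0:ℝ) < (n:ℝ)^γ := by positivity
    have e : b n * n / (n:ℝ)^γ * (((n:ℝ) + m) / n - 1) = (m * b n) / (n:ℝ)^γ := by
      field_simp; ring
    rw [e, ← sub_div]
    gcongr
  · intro a ha
    have e1 := (sl.mono_left (nhdsWithin_mono 1 (fun x (hx : x ∈ Iio (1:ℝ)) => ne_of_lt hx))).eventually
      (gt_mem_nhds ha)
    obtain ⟨c, hc1, hc⟩ := (e1.and (Ioo_mem_nhdsLT (show (0:ℝ) < 1 by norm_num))).exists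
    filter_upwards [(Q c hc.1 hc.2.ne).eventually (gt_mem_nhds hc1), eventually_gt_atTop 0,
      (Fl c hc.1).eventually (gt_mem_nhds hc.2)] with n hn hn0 hf
    refine lt_of_le_of_lt ?_ hn
    have hn0' : (0:ℝ) < n := by exact_mod_cast hn0
    have hle : ⌊c * n⌋₊ ≤ n := by
      have : (⌊c * n⌋₊ : ℝ) < n := by rwa [div_lt_iff₀ hn0', one_mul] at hf
      exact_mod_cast this.le
    obtain ⟨m, hm⟩ := Nat.exists_eq_add_of_le hle
    have := dn m ⌊c * n⌋₊
    rw [← hm] at this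
    rw [le_div_iff_of_neg (by linarith)]
    have hmr : (⌊c * n⌋₊ : ℝ) = n - m := by rw [eq_sub_iff_add_eq]; exact_mod_cast hm.symm
    rw [hmr]
    have hp : (0:ℝ) < (n:ℝ)^γ := by positivity
    have e : b n * n / (n:ℝ)^γ * (((n:ℝ) - m) / n - 1) = (-(m * b n)) / (n:ℝ)^γ := by
      field_simp; ring
    rw [e, ← sub_div]
    gcongr
    linarith

theorem En_tel (n : ℕ) (f : ℤ × ℤ → ℝ) : En n f = f (0,0)
    + ∑ k ∈ Finset.range n, (En k (fun z => stepAvg f z - f z) - hn k f) := by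
  induction n with
  | zero => simp [En_zero]
  | succ n ih =>
    rw [Finset.sum_range_succ, En_succ', En_sub]
    linarith

theorem En_one_anti : Antitone (fun n => En n (fun _ => 1)) := by
  apply antitone_nat_of_succ_le
  intro n
  rw [En_succ', stepAvg_one]
  have := hn_nonneg n (f := fun _ => 1) (fun _ _ => zero_le_one)
  linarith

theorem lim_one_sum : Tendsto (fun n : ℕ => (∑ j ∈ Finset.range n, En j (fun _ => 1)) / (n:ℝ)^((3:ℝ)/4))
    atTop (𝓝 (kp / (3/4 * Real.Gamma (3/4)))) := by
  have := kar_G gr_one (fun _ => zero_le_one) kp_pos.le 3 (by norm_num) lim_G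
  rw [Real.Gamma_add_one (by norm_num)] at this
  exact_mod_cast this

theorem lim_one : Tendsto (fun n : ℕ => En n (fun _ => 1) * (n:ℝ)^((1:ℝ)/4)) atTop
    (𝓝 (kp / Real.Gamma (3/4))) := by
  have := mono_density En_one_anti (by norm_num) lim_one_sum
  have hg : Real.Gamma (3/4) ≠ 0 := (Real.Gamma_pos_of_pos (by norm_num)).ne'
  rw [show kp / (3/4 * Real.Gamma (3/4)) * (3/4) = kp / Real.Gamma (3/4) by field_simp] at this
  refine this.congr' ?_
  filter_upwards [eventually_gt_atTop 0] with n hn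
  have hn0 : (0:ℝ) < n := by exact_mod_cast hn
  rw [show (1:ℝ)/4 = 1 - 3/4 by norm_num, Real.rpow_sub hn0, Real.rpow_one, mul_div_assoc]

theorem gr_abs : Gr (fun z : ℤ × ℤ => |(z.1:ℝ)|) := Gr.of_lin (C := 1) fun z => by
  rw [abs_abs]; linarith [abs_nonneg (z.2:ℝ)]

theorem gr_sq : Gr (fun z : ℤ × ℤ => (z.1:ℝ)^2) := ⟨1, zero_le_one, fun z => by
  show |(z.1:ℝ)^2| ≤ 1 * wt z
  rw [abs_of_nonneg (sq_nonneg _), ← sq_abs]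
  unfold wt
  nlinarith [abs_nonneg (z.2:ℝ), abs_nonneg (z.1:ℝ)]⟩

theorem lim_habs : Tendsto (fun n : ℕ => (∑ j ∈ Finset.range n, hn j (fun z => |(z.1:ℝ)|)) / (n:ℝ)^((1:ℝ)/4))
    atTop (𝓝 (kp / 4 / (1/4 * Real.Gamma (1/4)))) := by
  have h : Tendsto (fun ε => √ε^1 * Hs (1 - ε^2) (fun z => |(z.1:ℝ)|)) (𝓝[>] 0) (𝓝 (kp/4)) := by
    refine lim_MA.congr' ?_
    filter_upwards [small_ev] with ε hε
    rw [Hs_abs hε.1 (by linarith [hε.2]), pow_one]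
  have := kar_H gr_abs (fun _ _ => abs_nonneg _) (by linarith [kp_pos]) 1 (by norm_num) h
  rw [Real.Gamma_add_one (by norm_num)] at this
  exact_mod_cast this

theorem lim_hsq : Tendsto (fun n : ℕ => (∑ j ∈ Finset.range n, hn j (fun z => (z.1:ℝ)^2)) / (n:ℝ)^((3:ℝ)/4))
    atTop (𝓝 (kp / 16 / (3/4 * Real.Gamma (3/4)))) := by
  have h : Tendsto (fun ε => √ε^3 * Hs (1 - ε^2) (fun z => (z.1:ℝ)^2)) (𝓝[>] 0) (𝓝 (kp/16)) := by
    refine lim_MB.congr' ?_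
    filter_upwards [small_ev] with ε hε
    rw [Hs_sq hε.1 (by linarith [hε.2])]
  have := kar_H gr_sq (fun _ _ => sq_nonneg _) (by linarith [kp_pos]) 3 (by norm_num) h
  rw [Real.Gamma_add_one (by norm_num)] at this
  exact_mod_cast this

theorem lim_drs : Tendsto (fun n : ℕ => (∑ j ∈ Finset.range n, En j dr) / (n:ℝ)^((1:ℝ)/4))
    atTop (𝓝 (kp / (1/4 * Real.Gamma (1/4)))) := by
  have h : Tendsto (fun ε => √ε^1 * Gt (1 - ε^2) dr) (𝓝[>] 0) (𝓝 kp) := by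
    simpa only [pow_one] using lim_dr
  have := kar_G gr_dr dr_nonneg kp_pos.le 1 (by norm_num) h
  rw [Real.Gamma_add_one (by norm_num)] at this
  exact_mod_cast this

theorem finish {T : ℕ → ℝ} {U γ e c : ℝ} (hT : Tendsto (fun n : ℕ => T n / (n:ℝ)^γ) atTop (𝓝 U))
    (he : e = γ + 1/4) :
    Tendsto (fun n : ℕ => T n / En n (fun _ => 1) / (c * (n:ℝ)^e)) atTop
      (𝓝 (U / (kp / Real.Gamma (3/4)) / c)) := by
  have hg : 0 < Real.Gamma (3/4) := Real.Gamma_pos_of_pos (by norm_num)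
  have := (hT.div lim_one (div_pos kp_pos hg).ne').div_const c
  refine this.congr' ?_
  filter_upwards [eventually_gt_atTop 0] with n hn
  have hn0 : (0:ℝ) < n := by exact_mod_cast hn
  simp only [Pi.div_apply]
  rw [he, Real.rpow_add hn0]
  simp only [div_eq_mul_inv, mul_inv]
  ring

theorem En_x (n : ℕ) : En n (fun z => (z.1:ℝ)) = ∑ k ∈ Finset.range n, hn k (fun z => |(z.1:ℝ)|) := by
  rw [En_tel]
  simp only [Int.cast_zero, zero_add]
  refine Finset.sum_congr rfl fun k _ => ?_
  have e1 : (fun z : ℤ × ℤ => stepAvg (fun z => (z.1:ℝ)) z - z.1) = fun _ => 0 * 1 := by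
    funext z; unfold stepAvg; push_cast; ring
  have e2 : hn k (fun z => (z.1:ℝ)) = hn k (fun z => (-1) * |(z.1:ℝ)|) := by
    apply hn_congr
    rintro z ⟨_, hz⟩
    have : (z.1:ℝ) ≤ 0 := by exact_mod_cast hz
    rw [abs_of_nonpos this]; ring
  rw [e1, e2, En_smul, hn_smul]; ring

theorem En_ysq (n : ℕ) : En n (fun z => (z.2:ℝ)^2) = 1/2 * ∑ k ∈ Finset.range n, En k (fun _ => 1) := by
  rw [En_tel, Finset.mul_sum]
  simp only [Int.cast_zero, ne_eq, OfNat.ofNat_ne_zero, not_false_eq_true, zero_pow, zero_add]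
  refine Finset.sum_congr rfl fun k _ => ?_
  have e1 : (fun z : ℤ × ℤ => stepAvg (fun z => (z.2:ℝ)^2) z - (z.2:ℝ)^2) = fun _ => 1/2 * 1 := by
    funext z; unfold stepAvg; push_cast; ring
  have e2 : hn k (fun z => (z.2:ℝ)^2) = hn k (fun _ => 0 * 1) := by
    apply hn_congr
    rintro z ⟨hz, _⟩
    rw [hz]; simp
  rw [e1, e2, En_smul, hn_smul]; ring

theorem En_xsq (n : ℕ) : En n (fun z => (z.1:ℝ)^2) = 1/2 * ∑ k ∈ Finset.range n, En k (fun _ => 1)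
    - ∑ k ∈ Finset.range n, hn k (fun z => (z.1:ℝ)^2) := by
  rw [En_tel, Finset.mul_sum, ← Finset.sum_sub_distrib]
  simp only [Int.cast_zero, ne_eq, OfNat.ofNat_ne_zero, not_false_eq_true, zero_pow, zero_add]
  refine Finset.sum_congr rfl fun k _ => ?_
  have e1 : (fun z : ℤ × ℤ => stepAvg (fun z => (z.1:ℝ)^2) z - (z.1:ℝ)^2) = fun _ => 1/2 * 1 := by
    funext z; unfold stepAvg; push_cast; ring
  rw [e1, En_smul]

theorem En_rad (n : ℕ) : En n rad = ∑ k ∈ Finset.range n, En k dr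
    - ∑ k ∈ Finset.range n, hn k (fun z => |(z.1:ℝ)|) := by
  rw [En_tel, ← Finset.sum_sub_distrib, show rad (0,0) = 0 by simp [rad], zero_add]
  refine Finset.sum_congr rfl fun k _ => ?_
  have e2 : hn k rad = hn k (fun z => |(z.1:ℝ)|) := by
    apply hn_congr
    rintro z ⟨hz, _⟩
    simp [rad, hz, Real.sqrt_sq_eq_abs]
  rw [e2]; rfl

end Final

end SlitAux

theorem slit_plane_endpoint_moments :
    Tendsto (fun n : ℕ =>
        endpointMean (fun p => (p.1 : ℝ)) n
          / (Real.Gamma (3/4) / Real.Gamma (1/4) * Real.sqrt n))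
      atTop (nhds 1)
    ∧ (∀ n : ℕ, endpointMean (fun p => (p.2 : ℝ)) n = 0)
    ∧ Tendsto (fun n : ℕ =>
        endpointMean (fun p => Real.sqrt ((p.1 : ℝ) ^ 2 + (p.2 : ℝ) ^ 2)) n
          / (3 * (Real.Gamma (3/4) / Real.Gamma (1/4)) * Real.sqrt n))
      atTop (nhds 1)
    ∧ Tendsto (fun n : ℕ =>
        endpointMean (fun p => (p.1 : ℝ) ^ 2) n / (7 / 12 * n))
      atTop (nhds 1)
    ∧ Tendsto (fun n : ℕ =>
        endpointMean (fun p => (p.2 : ℝ) ^ 2) n / (2 / 3 * n))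
      atTop (nhds 1) := by
  have g3 : Real.Gamma (3/4) ≠ 0 := (Real.Gamma_pos_of_pos (by norm_num)).ne'
  have g1 : Real.Gamma (1/4) ≠ 0 := (Real.Gamma_pos_of_pos (by norm_num)).ne'
  have hk := SlitAux.kp_pos.ne'
  have hone : ∀ n : ℕ, (n:ℝ) = (n:ℝ)^(1:ℝ) := fun n => (Real.rpow_one _).symm
  refine ⟨?_, ?_, ?_, ?_, ?_⟩
  · have := SlitAux.finish (e := 1/2) (c := Real.Gamma (3/4) / Real.Gamma (1/4)) SlitAux.lim_habs (by norm_num)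
    have e : SlitAux.kp / 4 / (1/4 * Real.Gamma (1/4)) / (SlitAux.kp / Real.Gamma (3/4))
        / (Real.Gamma (3/4) / Real.Gamma (1/4)) = 1 := by field_simp
    rw [e] at this
    refine this.congr fun n => ?_
    rw [SlitAux.endpointMean_eq, SlitAux.En_x, Real.sqrt_eq_rpow]
  · intro n
    rw [SlitAux.endpointMean_eq, SlitAux.En_y, zero_div]
  · have h := SlitAux.lim_drs.sub SlitAux.lim_habs
    simp only [← sub_div, ← SlitAux.En_rad] at h
    have := SlitAux.finish (e := 1/2) (c := 3 * (Real.Gamma (3/4) / Real.Gamma (1/4))) h (by norm_num)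
    have e : (SlitAux.kp / (1/4 * Real.Gamma (1/4)) - SlitAux.kp / 4 / (1/4 * Real.Gamma (1/4)))
        / (SlitAux.kp / Real.Gamma (3/4)) / (3 * (Real.Gamma (3/4) / Real.Gamma (1/4))) = 1 := by
      field_simp; norm_num
    simp only [← sub_div] at e
    rw [e] at this
    refine this.congr fun n => ?_
    rw [SlitAux.endpointMean_eq, Real.sqrt_eq_rpow]
    rfl
  · have h := (SlitAux.lim_one_sum.const_mul (1/2)).sub SlitAux.lim_hsq
    simp only [← mul_div_assoc, ← sub_div, ← SlitAux.En_xsq] at h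
    have := SlitAux.finish (e := 1) (c := 7/12) h (by norm_num)
    have e : (1 / 2 * SlitAux.kp - SlitAux.kp / 16) / (3/4 * Real.Gamma (3/4))
        / (SlitAux.kp / Real.Gamma (3/4)) / (7/12) = 1 := by
      field_simp; norm_num
    rw [e] at this
    refine this.congr fun n => ?_
    rw [SlitAux.endpointMean_eq, Real.rpow_one]
  · have h := SlitAux.lim_one_sum.const_mul (1/2)
    simp only [← mul_div_assoc, ← SlitAux.En_ysq] at h
    have := SlitAux.finish (e := 1) (c := 2/3) h (by norm_num)
    have e : 1 / 2 * SlitAux.kp / (3/4 * Real.Gamma (3/4))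
        / (SlitAux.kp / Real.Gamma (3/4)) / (2/3) = 1 := by
      field_simp; norm_num
    rw [e] at this
    refine this.congr fun n => ?_
    rw [SlitAux.endpointMean_eq, Real.rpow_one]
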